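/- For every field k there exists a k-Hopf algebra H whose antipode is surjective but not injective, and such that every k-bialgebra homomorphism from a k-Hopf algebra with bijective antipode to H is trivial; in particular, H is not a quotient (nor the image under any nontrivial morphism) of a Hopf algebra with bijective antipode. -/

import Mathlib

structure RedSys (k Λ R I : Type*) [Field k] where
  C : R → Finset I
  X : R → I → Λ
  Y : R → I → Λ
  ld : R → I
  ld_mem : ∀ r, ld r ∈ C r
  kap : R → k
  M : Λ → ℕ
  M_pos : ∀ l, 0 < M l
  lead_inj : ∀ r s, X r (ld r) = X s (ld s) → Y r (ld r) = Y s (ld s) → r = s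
  decr : ∀ r, ∀ c ∈ C r, c ≠ ld r → M (X r c) + M (Y r c) < M (X r (ld r)) + M (Y r (ld r))
  hov : ∀ (F : List Λ → (List Λ →₀ k)) (r s : R), Y r (ld r) = X s (ld s) →
    (∀ t z, M (X t (ld t)) + M (Y t (ld t)) + M z <
        M (X r (ld r)) + M (Y r (ld r)) + M (Y s (ld s)) →
      ∑ c ∈ C t, F [X t c, Y t c, z] = kap t • F [z]) →
    (∀ t x, M x + M (X t (ld t)) + M (Y t (ld t)) <
        M (X r (ld r)) + M (Y r (ld r)) + M (Y s (ld s)) →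
      ∑ c ∈ C t, F [x, X t c, Y t c] = kap t • F [x]) →
    ∑ c ∈ C r, F [X r c, Y r c, Y s (ld s)] - kap r • F [Y s (ld s)] =
    ∑ c ∈ C s, F [X r (ld r), X s c, Y s c] - kap s • F [X r (ld r)]

theorem double_sum_lemma {I J W : Type*} [AddCommGroup W] (C : Finset I) (D : Finset J)
    (G : I → J → W) (P : I → W) (Q : J → W) (c0 : I) (d0 : J) (hc0 : c0 ∈ C) (hd0 : d0 ∈ D)
    (h1 : ∀ c ∈ C, c ≠ c0 → ∑ d ∈ D, G c d = P c)
    (h2 : ∀ d ∈ D, d ≠ d0 → ∑ c ∈ C, G c d = Q d)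
    (h3 : ∑ c ∈ C, P c = ∑ d ∈ D, Q d) :
    ∑ c ∈ C, G c d0 - Q d0 = ∑ d ∈ D, G c0 d - P c0 := by
  classical
  have e1 : ∑ c ∈ C, (∑ d ∈ D, G c d - P c) = ∑ d ∈ D, G c0 d - P c0 := by
    rw [Finset.sum_eq_single c0]
    · intro c hc hne
      rw [h1 c hc hne, sub_self]
    · intro h; exact absurd hc0 h
  have e2 : ∑ d ∈ D, (∑ c ∈ C, G c d - Q d) = ∑ c ∈ C, G c d0 - Q d0 := by
    rw [Finset.sum_eq_single d0]
    · intro c hc hne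
      rw [h2 c hc hne, sub_self]
    · intro h; exact absurd hd0 h
  rw [← e1, ← e2, Finset.sum_sub_distrib, Finset.sum_sub_distrib, h3, Finset.sum_comm]

namespace RedSys

variable {k Λ R I : Type*} [Field k] (A : RedSys k Λ R I)

def Bad (w : List Λ) : Prop :=
  ∃ r α β, w = α ++ A.X r (A.ld r) :: A.Y r (A.ld r) :: β

def mu (w : List Λ) : ℕ := (w.map A.M).sum

@[simp] theorem mu_append (v w : List Λ) : A.mu (v ++ w) = A.mu v + A.mu w := by
  simp [mu]

@[simp] theorem mu_cons (v) (w : List Λ) : A.mu (v :: w) = A.M v + A.mu w := by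
  simp [mu]

@[simp] theorem mu_nil : A.mu [] = 0 := by
  simp [mu]

open Classical in
noncomputable def N (w : List Λ) : List Λ →₀ k :=
  if h : A.Bad w then
    A.kap h.choose • N (h.choose_spec.choose ++ h.choose_spec.choose_spec.choose) -
    ∑ c : {c // c ∈ (A.C h.choose).erase (A.ld h.choose)},
      N (h.choose_spec.choose ++ A.X h.choose c :: A.Y h.choose c ::
        h.choose_spec.choose_spec.choose)
  else Finsupp.single w 1
termination_by A.mu w
decreasing_by
  · have e := h.choose_spec.choose_spec.choose_spec
    have := A.M_pos (A.X h.choose (A.ld h.choose))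
    conv_rhs => rw [e]
    simp only [mu_append, mu_cons]
    omega
  · have e := h.choose_spec.choose_spec.choose_spec
    have hc := c.2
    rw [Finset.mem_erase] at hc
    have := A.decr h.choose c hc.2 hc.1
    conv_rhs => rw [e]
    simp only [mu_append, mu_cons]
    omega

theorem N_normal (w : List Λ) (h : ¬ A.Bad w) : A.N w = Finsupp.single w 1 := by
  rw [N, dif_neg h]

noncomputable def E (r : R) (α β : List Λ) : List Λ →₀ k :=
  ∑ c ∈ A.C r, A.N (α ++ A.X r c :: A.Y r c :: β) - A.kap r • A.N (α ++ β)

theorem N_bad (w : List Λ) (h : A.Bad w) :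
    ∃ r α β, w = α ++ A.X r (A.ld r) :: A.Y r (A.ld r) :: β ∧ A.E r α β = 0 := by
  classical
  refine ⟨h.choose, h.choose_spec.choose, h.choose_spec.choose_spec.choose,
    h.choose_spec.choose_spec.choose_spec, ?_⟩
  have e := h.choose_spec.choose_spec.choose_spec
  have hN := RedSys.N.eq_1 A w
  rw [dif_pos h] at hN
  have e3 := congrArg A.N e
  rw [E, ← Finset.add_sum_erase _ _ (A.ld_mem h.choose), ← e3, hN,
    ← Finset.sum_coe_sort ((A.C h.choose).erase (A.ld h.choose))]
  abel

theorem lead_le (r : R) (c) (hc : c ∈ A.C r) :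
    A.M (A.X r c) + A.M (A.Y r c) ≤ A.M (A.X r (A.ld r)) + A.M (A.Y r (A.ld r)) := by
  by_cases h : c = A.ld r
  · rw [h]
  · exact (A.decr r c hc h).le

theorem E_disjoint (r s : R) (α γ β : List Λ)
    (IH : ∀ t α' β', A.mu (α' ++ A.X t (A.ld t) :: A.Y t (A.ld t) :: β') <
      A.mu (α ++ A.X r (A.ld r) :: A.Y r (A.ld r) :: (γ ++ A.X s (A.ld s) :: A.Y s (A.ld s) :: β))
      → A.E t α' β' = 0) :
    A.E r α (γ ++ A.X s (A.ld s) :: A.Y s (A.ld s) :: β) =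
    A.E s (α ++ A.X r (A.ld r) :: A.Y r (A.ld r) :: γ) β := by
  have key := double_sum_lemma (A.C r) (A.C s)
    (fun c d => A.N (α ++ A.X r c :: A.Y r c :: (γ ++ A.X s d :: A.Y s d :: β)))
    (fun c => A.kap s • A.N (α ++ A.X r c :: A.Y r c :: (γ ++ β)))
    (fun d => A.kap r • A.N (α ++ (γ ++ A.X s d :: A.Y s d :: β)))
    (A.ld r) (A.ld s) (A.ld_mem r) (A.ld_mem s) ?_ ?_ ?_
  · simpa [E] using key
  · intro c hc hne
    have h := IH s (α ++ A.X r c :: A.Y r c :: γ) β ?_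
    · rw [E, sub_eq_zero] at h
      simpa using h
    · have := A.decr r c hc hne
      simp; omega
  · intro d hd hne
    have h := IH r α (γ ++ A.X s d :: A.Y s d :: β) ?_
    · rw [E, sub_eq_zero] at h
      simpa using h
    · have := A.decr s d hd hne
      simp; omega
  · rw [← Finset.smul_sum, ← Finset.smul_sum]
    have h1 := IH r α (γ ++ β) ?_
    have h2 := IH s (α ++ γ) β ?_
    · rw [E, sub_eq_zero] at h1 h2
      rw [h1]
      simp only [List.append_assoc] at h2
      rw [h2, smul_smul, smul_smul, mul_comm]
    · have := A.M_pos (A.X r (A.ld r))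
      simp; omega
    · have := A.M_pos (A.X s (A.ld s))
      simp; omega

theorem E_overlap (r s : R) (α β : List Λ) (hrs : A.Y r (A.ld r) = A.X s (A.ld s))
    (IH : ∀ t α' β', A.mu (α' ++ A.X t (A.ld t) :: A.Y t (A.ld t) :: β') <
      A.mu (α ++ A.X r (A.ld r) :: A.Y r (A.ld r) :: A.Y s (A.ld s) :: β)
      → A.E t α' β' = 0) :
    A.E r α (A.Y s (A.ld s) :: β) =
    A.E s (α ++ [A.X r (A.ld r)]) β := by
  have key := A.hov (fun w => A.N (α ++ w ++ β)) r s hrs ?_ ?_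
  · simpa [E] using key
  · intro t z h
    have h := IH t α (z :: β) ?_
    · rw [E, sub_eq_zero] at h
      simpa using h
    · simp; omega
  · intro t z h
    have h := IH t (α ++ [z]) β ?_
    · rw [E, sub_eq_zero] at h
      simpa using h
    · simp; omega

theorem E_eq_of_le (r s : R) (α β α' β' : List Λ)
    (hw : α ++ A.X r (A.ld r) :: A.Y r (A.ld r) :: β =
      α' ++ A.X s (A.ld s) :: A.Y s (A.ld s) :: β')
    (hle : α.length ≤ α'.length)
    (IH : ∀ t γ δ, A.mu (γ ++ A.X t (A.ld t) :: A.Y t (A.ld t) :: δ) <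
      A.mu (α ++ A.X r (A.ld r) :: A.Y r (A.ld r) :: β)
      → A.E t γ δ = 0) : A.E r α β = A.E s α' β' := by
  obtain ⟨γ, rfl, h2⟩ | ⟨γ, rfl, h2⟩ := List.append_eq_append_iff.1 hw
  · match γ, h2 with
    | [], h2 =>
      simp only [List.nil_append, List.cons.injEq] at h2
      obtain ⟨h3, h4, rfl⟩ := h2
      have := A.lead_inj r s h3 h4
      subst this
      simp
    | [x], h2 =>
      simp only [List.cons_append, List.nil_append, List.cons.injEq] at h2
      obtain ⟨rfl, h4, rfl⟩ := h2
      exact A.E_overlap r s α β' h4 IH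
    | x :: y :: γ, h2 =>
      simp only [List.cons_append, List.cons.injEq] at h2
      obtain ⟨rfl, rfl, rfl⟩ := h2
      exact A.E_disjoint r s α γ β' IH
  · have : γ = [] := by
      simp at hle
      exact hle
    subst this
    simp only [List.nil_append, List.cons.injEq] at h2
    obtain ⟨h3, h4, rfl⟩ := h2
    have := A.lead_inj s r h3 h4
    subst this
    simp

theorem E_zero (r : R) (α β : List Λ) : A.E r α β = 0 := by
  induction hn : A.mu (α ++ A.X r (A.ld r) :: A.Y r (A.ld r) :: β) using Nat.strong_induction_on
    generalizing r α β with
  | _ n ih =>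
  subst hn
  obtain ⟨s, α', β', hw, h0⟩ := A.N_bad (α ++ A.X r (A.ld r) :: A.Y r (A.ld r) :: β)
    ⟨r, α, β, rfl⟩
  rcases le_total α.length α'.length with hle | hle
  · rw [A.E_eq_of_le r s α β α' β' hw hle, h0]
    intro t γ δ h
    exact ih _ h t γ δ rfl
  · rw [← A.E_eq_of_le s r α' β' α β hw.symm hle, h0]
    intro t γ δ h
    rw [← hw] at h
    exact ih _ h t γ δ rfl

theorem N_rel (r : R) (α β : List Λ) :
    ∑ c ∈ A.C r, A.N (α ++ A.X r c :: A.Y r c :: β) = A.kap r • A.N (α ++ β) :=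
  sub_eq_zero.1 (A.E_zero r α β)

/-- induction principle on words -/
theorem word_ind (P : List Λ → Prop) (h0 : ∀ w, ¬ A.Bad w → P w)
    (h1 : ∀ r α β, P (α ++ β) →
      (∀ c ∈ A.C r, c ≠ A.ld r → P (α ++ A.X r c :: A.Y r c :: β)) →
      P (α ++ A.X r (A.ld r) :: A.Y r (A.ld r) :: β)) (w : List Λ) : P w := by
  induction hn : A.mu w using Nat.strong_induction_on generalizing w with
  | _ n ih =>
  subst hn
  by_cases hb : A.Bad w
  · obtain ⟨r, α, β, rfl⟩ := hb
    apply h1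
    · refine ih _ ?_ _ rfl
      have := A.M_pos (A.X r (A.ld r))
      simp; omega
    · intro c hc hne
      refine ih _ ?_ _ rfl
      have := A.decr r c hc hne
      simp; omega
  · exact h0 w hb

theorem N_lead (r : R) (α β : List Λ) [DecidableEq I] :
    A.N (α ++ A.X r (A.ld r) :: A.Y r (A.ld r) :: β) = A.kap r • A.N (α ++ β) -
      ∑ c ∈ (A.C r).erase (A.ld r), A.N (α ++ A.X r c :: A.Y r c :: β) := by
  rw [← A.N_rel, ← Finset.add_sum_erase _ _ (A.ld_mem r)]
  abel

noncomputable def rhoL (x : Λ) : (List Λ →₀ k) →ₗ[k] (List Λ →₀ k) :=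
  Finsupp.lsum k (fun w => LinearMap.toSpanSingleton k _ (A.N (x :: w)))

@[simp] theorem rhoL_single (x : Λ) (w : List Λ) (a : k) :
    A.rhoL x (Finsupp.single w a) = a • A.N (x :: w) := by
  simp [rhoL]

theorem rhoL_N (x : Λ) (w : List Λ) : A.rhoL x (A.N w) = A.N (x :: w) := by
  classical
  induction w using A.word_ind with
  | h0 w hw => rw [A.N_normal w hw]; simp
  | h1 r α β h1 h2 =>
    rw [A.N_lead, ← List.cons_append, A.N_lead, map_sub, map_smul, h1, map_sum]
    congr 1
    apply Finset.sum_congr rfl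
    intro c hc
    rw [Finset.mem_erase] at hc
    exact h2 c hc.2 hc.1

theorem N_supp_normal (w : List Λ) : ∀ v ∈ (A.N w).support, ¬ A.Bad v := by
  classical
  suffices A.N w ∈ Finsupp.supported k k {v | ¬ A.Bad v} by
    intro v hv
    exact (Finsupp.mem_supported _ _).1 this hv
  induction w using A.word_ind with
  | h0 w hw =>
    rw [A.N_normal w hw]
    exact Finsupp.single_mem_supported _ _ hw
  | h1 r α β h1 h2 =>
    rw [A.N_lead]
    refine Submodule.sub_mem _ (Submodule.smul_mem _ _ h1) (Submodule.sum_mem _ ?_)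
    intro c hc
    rw [Finset.mem_erase] at hc
    exact h2 c hc.2 hc.1

theorem N_supp_pred (Q : Λ → Prop)
    (hQ : ∀ r, ∀ c ∈ A.C r, Q (A.X r (A.ld r)) → Q (A.Y r (A.ld r)) →
      Q (A.X r c) ∧ Q (A.Y r c)) (w : List Λ) (hw : ∀ l ∈ w, Q l) :
    A.N w ∈ Finsupp.supported k k {v | ∀ l ∈ v, Q l} := by
  classical
  induction w using A.word_ind with
  | h0 w hb =>
    rw [A.N_normal w hb]
    exact Finsupp.single_mem_supported _ _ hw
  | h1 r α β h1 h2 =>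
    rw [A.N_lead]
    simp only [List.mem_append, List.mem_cons] at hw
    refine Submodule.sub_mem _ (Submodule.smul_mem _ _ (h1 ?_)) (Submodule.sum_mem _ ?_)
    · intro l hl
      apply hw
      simp only [List.mem_append] at hl
      tauto
    intro c hc
    rw [Finset.mem_erase] at hc
    refine h2 c hc.2 hc.1 ?_
    have := hQ r c hc.2 (hw _ (by simp)) (hw _ (by simp))
    intro l hl
    simp only [List.mem_append, List.mem_cons] at hl
    rcases hl with h | rfl | rfl | h
    · exact hw _ (by tauto)
    · exact this.1
    · exact this.2
    · exact hw _ (by tauto)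

/-! the algebra -/

inductive Rel : FreeAlgebra k Λ → FreeAlgebra k Λ → Prop
  | mk (r : R) : Rel (∑ c ∈ A.C r, FreeAlgebra.ι k (A.X r c) * FreeAlgebra.ι k (A.Y r c))
      (algebraMap k _ (A.kap r))

abbrev Alg : Type _ := RingQuot A.Rel

noncomputable def gen (l : Λ) : A.Alg := RingQuot.mkAlgHom k A.Rel (FreeAlgebra.ι k l)

noncomputable def wd (w : List Λ) : A.Alg := (w.map A.gen).prod

@[simp] theorem wd_nil : A.wd [] = 1 := by simp [wd]
@[simp] theorem wd_cons (x) (w : List Λ) : A.wd (x :: w) = A.gen x * A.wd w := by simp [wd]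
@[simp] theorem wd_append (v w : List Λ) : A.wd (v ++ w) = A.wd v * A.wd w := by simp [wd]

theorem gen_rel (r : R) :
    ∑ c ∈ A.C r, A.gen (A.X r c) * A.gen (A.Y r c) = algebraMap k _ (A.kap r) := by
  have := RingQuot.mkAlgHom_rel k (Rel.mk (A := A) r)
  rw [map_sum] at this
  simpa [gen] using this

noncomputable def lift {B : Type*} [Semiring B] [Algebra k B] (f : Λ → B)
    (hf : ∀ r, ∑ c ∈ A.C r, f (A.X r c) * f (A.Y r c) = algebraMap k _ (A.kap r)) :
    A.Alg →ₐ[k] B :=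
  RingQuot.liftAlgHom k ⟨FreeAlgebra.lift k f, by
    rintro _ _ ⟨r⟩
    simpa using hf r⟩

@[simp] theorem lift_gen {B : Type*} [Semiring B] [Algebra k B] (f : Λ → B) (hf) (l : Λ) :
    A.lift f hf (A.gen l) = f l := by
  simp [lift, gen]

theorem hom_ext {B : Type*} [Semiring B] [Algebra k B] {f g : A.Alg →ₐ[k] B}
    (h : ∀ l, f (A.gen l) = g (A.gen l)) : f = g := by
  apply RingQuot.ringQuot_ext'
  apply FreeAlgebra.hom_ext
  funext l
  exact h l

theorem gen_induction {P : A.Alg → Prop} (h1 : ∀ a : k, P (algebraMap k _ a))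
    (h2 : ∀ x y, P x → P y → P (x + y)) (h3 : ∀ x y, P x → P y → P (x * y))
    (h4 : ∀ l, P (A.gen l)) (x : A.Alg) : P x := by
  obtain ⟨y, rfl⟩ := RingQuot.mkAlgHom_surjective k A.Rel x
  induction y using FreeAlgebra.induction with
  | grade0 a => simpa using h1 a
  | grade1 l => exact h4 l
  | mul x y hx hy => rw [map_mul]; exact h3 _ _ hx hy
  | add x y hx hy => rw [map_add]; exact h2 _ _ hx hy

noncomputable def ev : (List Λ →₀ k) →ₗ[k] A.Alg := Finsupp.lsum k (fun w =>
  LinearMap.toSpanSingleton k _ (A.wd w))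

@[simp] theorem ev_single (w : List Λ) (a : k) : A.ev (Finsupp.single w a) = a • A.wd w := by
  simp [ev]

theorem ev_N (w : List Λ) : A.ev (A.N w) = A.wd w := by
  classical
  induction w using A.word_ind with
  | h0 w hw => rw [A.N_normal w hw]; simp
  | h1 r α β h1 h2 =>
    rw [A.N_lead, map_sub, map_smul, h1, map_sum]
    rw [Finset.sum_congr rfl (g := fun c => A.wd α * ((A.gen (A.X r c) * A.gen (A.Y r c)) *
      A.wd β))]
    · have := A.gen_rel r
      rw [← Finset.add_sum_erase _ _ (A.ld_mem r), ← eq_sub_iff_add_eq] at this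
      rw [← Finset.mul_sum, ← Finset.sum_mul]
      simp only [wd_append, wd_cons]
      rw [← mul_assoc (A.gen _), this, sub_mul, mul_sub, Algebra.algebraMap_eq_smul_one]
      simp
    · intro c hc
      rw [Finset.mem_erase] at hc
      rw [h2 c hc.2 hc.1]
      simp [mul_assoc]

theorem rho_rel (r : R) (w : List Λ) :
  ∑ c ∈ A.C r, A.rhoL (A.X r c) (A.rhoL (A.Y r c) (A.N w)) = A.kap r • A.N w := by
  simp only [rhoL_N]
  exact A.N_rel r [] w

/-- normal part of the free module -/
noncomputable def nrm : (List Λ →₀ k) →ₗ[k] (List Λ →₀ k) := Finsupp.lsum k (fun w =>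
  LinearMap.toSpanSingleton k _ (A.N w))

@[simp] theorem nrm_single (w : List Λ) (a : k) : A.nrm (Finsupp.single w a) = a • A.N w := by
  simp [nrm]

theorem nrm_N (w : List Λ) : A.nrm (A.N w) = A.N w := by
  classical
  induction w using A.word_ind with
  | h0 w hw => rw [A.N_normal w hw]; simp [A.N_normal w hw]
  | h1 r α β h1 h2 =>
    rw [A.N_lead, map_sub, map_smul, h1, map_sum]
    congr 1
    apply Finset.sum_congr rfl
    intro c hc
    rw [Finset.mem_erase] at hc
    exact h2 c hc.2 hc.1

noncomputable abbrev NS : Submodule k (List Λ →₀ k) := LinearMap.range A.nrm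

noncomputable def rhoS (x : Λ) : Module.End k A.NS :=
  (A.rhoL x).restrict (by
    rintro _ ⟨v, rfl⟩
    induction v using Finsupp.induction_linear with
    | zero => simp
    | add f g hf hg => rw [map_add, map_add]; exact Submodule.add_mem _ hf hg
    | single w a =>
      rw [nrm_single, map_smul, rhoL_N]
      exact ⟨Finsupp.single (x :: w) a, by simp⟩)

noncomputable def rho : A.Alg →ₐ[k] Module.End k A.NS :=
  A.lift A.rhoS (by
    intro r
    ext ⟨_, v, rfl⟩ : 2
    simp only [LinearMap.sum_apply, Module.End.mul_apply, rhoS, AddSubmonoidClass.coe_finsetSum,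
      LinearMap.coe_restrict_apply, Module.algebraMap_end_apply, SetLike.val_smul]
    induction v using Finsupp.induction_linear with
    | zero => simp
    | add f g hf hg => simp only [map_add, Finset.sum_add_distrib, hf, hg, smul_add]
    | single w a =>
      simp only [nrm_single, map_smul]
      rw [← Finset.smul_sum, A.rho_rel, smul_comm])

noncomputable def NF : A.Alg →ₗ[k] (List Λ →₀ k) :=
  A.NS.subtype ∘ₗ LinearMap.applyₗ (⟨A.N [], ⟨Finsupp.single [] 1, by simp⟩⟩ : A.NS)
    ∘ₗ A.rho.toLinearMap

theorem NF_wd (w : List Λ) : A.NF (A.wd w) = A.N w := by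
  simp only [NF, LinearMap.comp_apply, AlgHom.toLinearMap_apply, LinearMap.applyₗ_apply_apply,
    Submodule.subtype_apply]
  induction w with
  | nil => simp
  | cons x w ih =>
    simp only [wd_cons, map_mul, Module.End.mul_apply]
    conv_lhs => enter [1, 1]; rw [rho, lift_gen]
    rw [rhoS, LinearMap.coe_restrict_apply, ih, rhoL_N]

theorem alg_span (x : A.Alg) : ∃ v : List Λ →₀ k, A.ev v = x := by
  induction x using A.gen_induction with
  | h1 a => exact ⟨Finsupp.single [] a, by simp [Algebra.algebraMap_eq_smul_one]⟩
  | h2 x y hx hy =>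
    obtain ⟨v, rfl⟩ := hx
    obtain ⟨w, rfl⟩ := hy
    exact ⟨v + w, by simp⟩
  | h3 x y hx hy =>
    obtain ⟨v, rfl⟩ := hx
    obtain ⟨w, rfl⟩ := hy
    change A.ev v * A.ev w ∈ LinearMap.range A.ev
    induction v using Finsupp.induction_linear with
    | zero => simp
    | add f g hf hg => rw [map_add, add_mul]; exact Submodule.add_mem _ hf hg
    | single w' a =>
      induction w using Finsupp.induction_linear with
      | zero => simp
      | add f g hf hg => rw [map_add, mul_add]; exact Submodule.add_mem _ hf hg
      | single w'' b =>
        exact ⟨Finsupp.single (w' ++ w'') (a * b), by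
          rw [ev_single, ev_single, ev_single, smul_mul_smul_comm, wd_append]⟩
  | h4 l => exact ⟨Finsupp.single [l] 1, by simp⟩

theorem NF_ev (v : List Λ →₀ k) : A.NF (A.ev v) = A.nrm v := by
  induction v using Finsupp.induction_linear with
  | zero => simp
  | add f g hf hg => simp [hf, hg]
  | single w a => simp [NF_wd]

theorem ev_nrm (v : List Λ →₀ k) : A.ev (A.nrm v) = A.ev v := by
  induction v using Finsupp.induction_linear with
  | zero => simp
  | add f g hf hg => simp [hf, hg]
  | single w a => simp [ev_N]

theorem ev_NF (x : A.Alg) : A.ev (A.NF x) = x := by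
  obtain ⟨v, rfl⟩ := A.alg_span x
  rw [NF_ev, ev_nrm]

theorem NF_supp_normal (x : A.Alg) : ∀ v ∈ (A.NF x).support, ¬ A.Bad v := by
  suffices A.NF x ∈ Finsupp.supported k k {v | ¬ A.Bad v} by
    intro v hv
    exact (Finsupp.mem_supported _ _).1 this hv
  obtain ⟨v, rfl⟩ := A.alg_span x
  rw [NF_ev]
  induction v using Finsupp.induction_linear with
  | zero => simp
  | add f g hf hg => rw [map_add]; exact Submodule.add_mem _ hf hg
  | single w a =>
    rw [nrm_single]
    exact Submodule.smul_mem _ _ ((Finsupp.mem_supported _ _).2 fun v hv => A.N_supp_normal w v hv)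

end RedSys

namespace HopfEx

abbrev J := ℕ × Fin 5

def kp (i : ℤ) : Fin 5 := ⟨(i % 3).toNat, by omega⟩

theorem kp_val (i : ℤ) : (kp i).val = (i % 3).toNat := rfl

theorem J_ne {c d : J} (h : c ≠ d) : c.1 ≠ d.1 ∨ c.2.val ≠ d.2.val := by
  by_contra hh
  push Not at hh
  exact h (Prod.ext hh.1 (Fin.ext hh.2))

def supp (i : ℤ) (a b : J) : Prop :=
  (i % 2 = 0 → (a.1 : ℤ) ≤ max (b.1 : ℤ) (-i)) ∧ (i % 2 = 1 → (b.1 : ℤ) ≤ max (a.1 : ℤ) (-i))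

instance (i a b) : Decidable (supp i a b) := by unfold supp; infer_instance

@[ext] structure Letter where
  i : ℤ
  a : J
  b : J
  h : supp i a b

def topn (i : ℤ) (a b : J) : ℕ := max (max a.1 b.1) (-i).toNat

def Letter.top (l : Letter) : ℕ := topn l.i l.a l.b

def mkL (i : ℤ) (a b : J) : Letter :=
  if h : supp i a b then ⟨i, a, b, h⟩ else ⟨0, (0, 0), (0, 0), by simp [supp]⟩

theorem mkL_pos {i a b} (h : supp i a b) : mkL i a b = ⟨i, a, b, h⟩ := dif_pos h

theorem mkL_inj {i a b i₂ a₂ b₂} (h : supp i a b) (h₂ : supp i₂ a₂ b₂)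
    (e : mkL i a b = mkL i₂ a₂ b₂) : i = i₂ ∧ a = a₂ ∧ b = b₂ := by
  rw [mkL_pos h, mkL_pos h₂] at e
  simpa using e

def q (j : ℤ) (c : J) : ℕ :=
  c.1 + if (c.2.val = (j % 3).toNat ∨ c.2.val = ((j - 1) % 3).toNat) then 1 else 0

def Mm (l : Letter) : ℕ := q l.i l.a + q l.i l.b + 1

theorem Mm_mkL {i a b} (h : supp i a b) : Mm (mkL i a b) = q i a + q i b + 1 := by
  rw [mkL_pos h]; rfl

/-- boxes -/
def bx (n : ℕ) : Finset J := Finset.range (n + 1) ×ˢ Finset.univ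

theorem mem_bx {n : ℕ} {c : J} : c ∈ bx n ↔ c.1 ≤ n := by
  simp [bx]

abbrev Rix := Bool × Letter

def valid : Rix → J → Prop
  | (false, l), c => supp l.i l.a c ∧ supp (l.i + 1) l.b c
  | (true, l), c => supp (l.i + 1) c l.a ∧ supp l.i c l.b

instance (r c) : Decidable (valid r c) := by
  rcases r with ⟨_ | _, l⟩ <;> unfold valid <;> infer_instance

def CC (r : Rix) : Finset J := (bx r.2.top).filter (valid r)

def XX : Rix → J → Letter
  | (false, l), c => mkL l.i l.a c
  | (true, l), c => mkL (l.i + 1) c l.a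

def YY : Rix → J → Letter
  | (false, l), c => mkL (l.i + 1) l.b c
  | (true, l), c => mkL l.i c l.b

def lead : Rix → J
  | (false, l) => (if l.i % 2 = 0 then max l.b.1 (-l.i - 1).toNat else max l.a.1 (-l.i).toNat,
      kp l.i)
  | (true, l) => (if l.i % 2 = 0 then max l.b.1 (-l.i).toNat else max l.a.1 (-l.i - 1).toNat,
      kp l.i)

theorem lead_col (r : Rix) : (lead r).2 = kp r.2.i := by
  rcases r with ⟨_ | _, l⟩ <;> rfl

theorem valid_le {r c} (h : valid r c) : c.1 ≤ r.2.top := by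
  rcases r with ⟨_ | _, ⟨i, a, b, hl⟩⟩ <;> 
  · simp only [valid, supp, Letter.top, topn] at *
    omega

theorem valid_lead (r) : valid r (lead r) := by
  rcases r with ⟨_ | _, ⟨i, a, b, hl⟩⟩ <;> 
  · have hl2 := hl
    simp only [supp] at hl2
    simp only [valid, supp, lead]
    split_ifs <;> omega

theorem valid_supp_false {i a b c} (h1 : supp i a c) (h2 : supp (i + 1) b c) : supp i a b := by
  simp only [supp] at *
  omega

theorem valid_supp_true {i a b c} (h1 : supp (i + 1) c a) (h2 : supp i c b) : supp i a b := by
  simp only [supp] at *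
  omega

theorem mem_CC {r c} : c ∈ CC r ↔ valid r c := by
  rw [CC, Finset.mem_filter, mem_bx]
  exact ⟨fun h => h.2, fun h => ⟨valid_le h, h⟩⟩

theorem sum_box {W : Type*} [AddCommMonoid W] (r : Rix) (n : ℕ) (hn : r.2.top ≤ n) (f : J → W) :
    ∑ c ∈ bx n, (if valid r c then f c else 0) = ∑ c ∈ CC r, f c := by
  rw [← Finset.sum_filter]
  congr 1
  ext c
  rw [mem_CC, Finset.mem_filter, mem_bx]
  exact ⟨fun h => h.2, fun h => ⟨(valid_le h).trans hn, h⟩⟩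

theorem supp_self (i a) : supp i a a := by
  simp only [supp]; omega

theorem q_le {i : ℤ} {c d : J} (h : c.1 ≤ d.1) (hd : d.2 = kp i) :
    q i c + q (i + 1) c ≤ q i d + q (i + 1) d := by
  have hd := congrArg Fin.val hd
  rw [kp_val] at hd
  simp only [q, add_sub_cancel_right]
  split_ifs <;> omega

theorem q_lt {i : ℤ} {c d : J} (h : c.1 ≤ d.1) (hd : d.2 = kp i) (hne : c ≠ d) :
    q i c + q (i + 1) c < q i d + q (i + 1) d := by
  have hne := J_ne hne
  have hd := congrArg Fin.val hd
  rw [kp_val] at hd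
  simp only [q, add_sub_cancel_right]
  split_ifs <;> omega

theorem valid_le_lead {r c} (h : valid r c) : c.1 ≤ (lead r).1 := by
  rcases r with ⟨_ | _, ⟨i, a, b, hl⟩⟩ <;>
  · have hl2 := hl
    simp only [supp] at hl2
    simp only [valid, supp] at h
    simp only [lead]
    split_ifs <;> omega

theorem decr (r : Rix) (c : J) (hc : c ∈ CC r) (hne : c ≠ lead r) :
    Mm (XX r c) + Mm (YY r c) < Mm (XX r (lead r)) + Mm (YY r (lead r)) := by
  have hv := mem_CC.1 hc
  have hl := valid_lead r
  have hlt := q_lt (valid_le_lead hv) (lead_col r) hne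
  rcases r with ⟨_ | _, ⟨i, a, b, h⟩⟩
  · simp only [XX, YY]
    rw [Mm_mkL hv.1, Mm_mkL hv.2, Mm_mkL hl.1, Mm_mkL hl.2]
    simp only at hlt ⊢
    omega
  · simp only [XX, YY]
    rw [Mm_mkL hv.1, Mm_mkL hv.2, Mm_mkL hl.1, Mm_mkL hl.2]
    simp only at hlt ⊢
    omega

theorem lead_inj (r s : Rix) (h1 : XX r (lead r) = XX s (lead s))
    (h2 : YY r (lead r) = YY s (lead s)) : r = s := by
  have hr := valid_lead r
  have hs := valid_lead s
  rcases r with ⟨_ | _, l⟩ <;> rcases s with ⟨_ | _, m⟩ <;>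
  · have e1 := mkL_inj hr.1 hs.1 h1
    have e2 := mkL_inj hr.2 hs.2 h2
    first
    | (exfalso; omega)
    | (congr 1
       ext1
       all_goals
         first
         | exact e1.1 | exact e2.1 | exact e1.2.1 | exact e2.2.1 | exact e1.2.2 | exact e2.2.2)

variable {k : Type*} [Field k]

def kapp (k : Type*) [Field k] (r : Rix) : k := if r.2.a = r.2.b then 1 else 0

theorem hov_ad {W : Type*} [AddCommGroup W] [Module k W] (F : List Letter → W) (l m : Letter)
    (hrs : YY (false, l) (lead (false, l)) = XX (true, m) (lead (true, m)))
    (h1 : ∀ t z, Mm (XX t (lead t)) + Mm (YY t (lead t)) + Mm z <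
        Mm (XX (false, l) (lead (false, l))) + Mm (YY (false, l) (lead (false, l))) +
          Mm (YY (true, m) (lead (true, m))) →
      ∑ c ∈ CC t, F [XX t c, YY t c, z] = kapp k t • F [z])
    (h2 : ∀ t x, Mm x + Mm (XX t (lead t)) + Mm (YY t (lead t)) <
        Mm (XX (false, l) (lead (false, l))) + Mm (YY (false, l) (lead (false, l))) +
          Mm (YY (true, m) (lead (true, m))) →
      ∑ c ∈ CC t, F [x, XX t c, YY t c] = kapp k t • F [x]) :
    ∑ c ∈ CC (false, l), F [XX (false, l) c, YY (false, l) c, YY (true, m) (lead (true, m))]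
      - kapp k (false, l) • F [YY (true, m) (lead (true, m))] =
    ∑ c ∈ CC (true, m), F [XX (false, l) (lead (false, l)), XX (true, m) c, YY (true, m) c]
      - kapp k (true, m) • F [XX (false, l) (lead (false, l))] := by
  have hr := valid_lead (false, l)
  have hs := valid_lead (true, m)
  obtain ⟨e1, e2, e3⟩ := mkL_inj hr.2 hs.1 hrs
  have cr := lead_col (false, l)
  have cs := lead_col (true, m)
  obtain ⟨i, a, d0, hl⟩ := l
  obtain ⟨i', c0, b', hm⟩ := m
  simp only at e1 e2 e3 cr cs
  obtain rfl : i = i' := by omega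
  clear e1 hrs
  have hc0 := e3
  have hd0 := e2.symm
  rw [hc0] at cr
  rw [hd0] at cs
  simp only [XX, YY, hc0, hd0] at h1 h2 ⊢
  simp only [valid, hc0, hd0] at hr hs
  rw [Mm_mkL hr.1, Mm_mkL hr.2, Mm_mkL hs.2] at h1 h2
  obtain ⟨n, hn1, hn2, hn3, hn4, hn5⟩ : ∃ n : ℕ, a.1 ≤ n ∧ c0.1 ≤ n ∧ d0.1 ≤ n ∧ b'.1 ≤ n ∧
      -i ≤ (n : ℤ) := by
    refine ⟨a.1 + c0.1 + d0.1 + b'.1 + (-i).toNat, ?_⟩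
    omega
  have key := double_sum_lemma (bx n) (bx n)
    (fun c d => if supp i a c ∧ supp (i + 1) d c ∧ supp i d b' then
      F [mkL i a c, mkL (i + 1) d c, mkL i d b'] else 0)
    (fun c => if c = b' ∧ supp i a c then F [mkL i a c] else 0)
    (fun d => if a = d ∧ supp i d b' then F [mkL i d b'] else 0)
    c0 d0 (mem_bx.2 hn2) (mem_bx.2 hn3) ?_ ?_ ?_
  · have s1 := sum_box (false, ⟨i, a, d0, hl⟩) n (by simp only [Letter.top, topn]; omega)
      (fun c => F [mkL i a c, mkL (i + 1) d0 c, mkL i d0 b'])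
    have s2 := sum_box (true, ⟨i, c0, b', hm⟩) n (by simp only [Letter.top, topn]; omega)
      (fun d => F [mkL i a c0, mkL (i + 1) d c0, mkL i d b'])
    simp only [valid] at s1 s2
    rw [← s1, ← s2]
    simp only [hr.1, hs.2, and_true, true_and] at key
    simp only [kapp, ite_smul, one_smul, zero_smul]
    exact key
  · intro c hc hne
    rw [mem_bx] at hc
    by_cases hac : supp i a c
    · by_cases hcb : supp i c b'
      · have := h2 (true, ⟨i, c, b', hcb⟩) (mkL i a c) ?_
        · rw [← sum_box _ n (by simp only [Letter.top, topn]; omega)] at this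
          simp only [valid, kapp, ite_smul, one_smul, zero_smul] at this
          simp only [hac, true_and, and_true]
          exact this
        · have hv := valid_lead (true, ⟨i, c, b', hcb⟩)
          simp only
          simp only [valid] at hv
          rw [Mm_mkL hac, Mm_mkL hv.1, Mm_mkL hv.2]
          have f1 : c.1 ≤ c0.1 := by
            clear h1 h2 hv
            rw [← hc0]
            simp only [supp, lead, Prod.ext_iff] at *
            split_ifs at * <;> omega
          have f2 : (lead (true, ⟨i, c, b', hcb⟩)).1 ≤ d0.1 := by
            clear h1 h2 hv
            rw [← hd0]
            simp only [supp, lead, Prod.ext_iff] at *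
            split_ifs at * <;> omega
          have f3 := q_lt f1 cr hne
          have f4 := q_le f2 cs
          omega
      · rw [Finset.sum_eq_zero, if_neg]
        · rintro ⟨rfl, -⟩
          exact hcb (supp_self i c)
        · intro d hd
          rw [if_neg]
          rintro ⟨-, h3, h4⟩
          exact hcb (valid_supp_true h3 h4)
    · simp [hac]
  · intro d hd hne
    rw [mem_bx] at hd
    by_cases hac : supp i d b'
    · by_cases hcb : supp i a d
      · have := h1 (false, ⟨i, a, d, hcb⟩) (mkL i d b') ?_
        · rw [← sum_box _ n (by simp only [Letter.top, topn]; omega)] at this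
          simp only [valid, kapp, ite_smul, one_smul, zero_smul] at this
          simp only [hac, and_true]
          exact this
        · have hv := valid_lead (false, ⟨i, a, d, hcb⟩)
          simp only
          simp only [valid] at hv
          rw [Mm_mkL hac, Mm_mkL hv.1, Mm_mkL hv.2]
          have f1 : d.1 ≤ d0.1 := by
            clear h1 h2 hv
            rw [← hd0]
            simp only [supp, lead, Prod.ext_iff] at *
            split_ifs at * <;> omega
          have f2 : (lead (false, ⟨i, a, d, hcb⟩)).1 ≤ c0.1 := by
            clear h1 h2 hv
            rw [← hc0]
            simp only [supp, lead, Prod.ext_iff] at *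
            split_ifs at * <;> omega
          have f3 := q_lt f1 cs hne
          have f4 := q_le f2 cr
          omega
      · rw [Finset.sum_eq_zero, if_neg]
        · rintro ⟨rfl, -⟩
          exact hcb (supp_self i a)
        · intro c hc
          rw [if_neg]
          rintro ⟨h3, h4, -⟩
          exact hcb (valid_supp_false h3 h4)
    · simp [hac]
  · rw [Finset.sum_eq_single b', Finset.sum_eq_single a]
    · simp
    · intro d _ hd
      rw [if_neg]
      exact fun h => hd h.1.symm
    · intro h; exact absurd (mem_bx.2 hn1) h
    · intro d _ hd
      rw [if_neg]
      exact fun h => hd h.1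
    · intro h; exact absurd (mem_bx.2 hn4) h

theorem hov_da {W : Type*} [AddCommGroup W] [Module k W] (F : List Letter → W) (l m : Letter)
    (hrs : YY (true, l) (lead (true, l)) = XX (false, m) (lead (false, m)))
    (h1 : ∀ t z, Mm (XX t (lead t)) + Mm (YY t (lead t)) + Mm z <
        Mm (XX (true, l) (lead (true, l))) + Mm (YY (true, l) (lead (true, l))) +
          Mm (YY (false, m) (lead (false, m))) →
      ∑ c ∈ CC t, F [XX t c, YY t c, z] = kapp k t • F [z])
    (h2 : ∀ t x, Mm x + Mm (XX t (lead t)) + Mm (YY t (lead t)) <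
        Mm (XX (true, l) (lead (true, l))) + Mm (YY (true, l) (lead (true, l))) +
          Mm (YY (false, m) (lead (false, m))) →
      ∑ c ∈ CC t, F [x, XX t c, YY t c] = kapp k t • F [x]) :
    ∑ c ∈ CC (true, l), F [XX (true, l) c, YY (true, l) c, YY (false, m) (lead (false, m))]
      - kapp k (true, l) • F [YY (false, m) (lead (false, m))] =
    ∑ c ∈ CC (false, m), F [XX (true, l) (lead (true, l)), XX (false, m) c, YY (false, m) c]
      - kapp k (false, m) • F [XX (true, l) (lead (true, l))] := by
  have hr := valid_lead (true, l)
  have hs := valid_lead (false, m)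
  obtain ⟨e1, e2, e3⟩ := mkL_inj hr.2 hs.1 hrs
  have cr := lead_col (true, l)
  have cs := lead_col (false, m)
  obtain ⟨i, a, d0, hl⟩ := l
  obtain ⟨i', c0, b', hm⟩ := m
  simp only at e1 e2 e3 cr cs
  obtain rfl : i = i' := by omega
  clear e1 hrs
  have hc0 := e2
  have hd0 := e3.symm
  rw [hc0] at cr
  rw [hd0] at cs
  simp only [XX, YY, hc0, hd0] at h1 h2 ⊢
  simp only [valid, hc0, hd0] at hr hs
  rw [Mm_mkL hr.1, Mm_mkL hr.2, Mm_mkL hs.2] at h1 h2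
  obtain ⟨n, hn1, hn2, hn3, hn4, hn5⟩ : ∃ n : ℕ, a.1 ≤ n ∧ c0.1 ≤ n ∧ d0.1 ≤ n ∧ b'.1 ≤ n ∧
      -i ≤ (n : ℤ) := by
    refine ⟨a.1 + c0.1 + d0.1 + b'.1 + (-i).toNat, ?_⟩
    omega
  have key := double_sum_lemma (bx n) (bx n)
    (fun c d => if supp (i + 1) c a ∧ supp i c d ∧ supp (i + 1) b' d then
      F [mkL (i + 1) c a, mkL i c d, mkL (i + 1) b' d] else 0)
    (fun c => if c = b' ∧ supp (i + 1) c a then F [mkL (i + 1) c a] else 0)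
    (fun d => if a = d ∧ supp (i + 1) b' d then F [mkL (i + 1) b' d] else 0)
    c0 d0 (mem_bx.2 hn2) (mem_bx.2 hn3) ?_ ?_ ?_
  · have s1 := sum_box (true, ⟨i, a, d0, hl⟩) n (by simp only [Letter.top, topn]; omega)
      (fun c => F [mkL (i + 1) c a, mkL i c d0, mkL (i + 1) b' d0])
    have s2 := sum_box (false, ⟨i, c0, b', hm⟩) n (by simp only [Letter.top, topn]; omega)
      (fun d => F [mkL (i + 1) c0 a, mkL i c0 d, mkL (i + 1) b' d])
    simp only [valid] at s1 s2
    rw [← s1, ← s2]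
    simp only [hr.1, hs.2, and_true, true_and] at key
    simp only [kapp, ite_smul, one_smul, zero_smul]
    exact key
  · intro c hc hne
    rw [mem_bx] at hc
    by_cases hac : supp (i + 1) c a
    · by_cases hcb : supp i c b'
      · have := h2 (false, ⟨i, c, b', hcb⟩) (mkL (i + 1) c a) ?_
        · rw [← sum_box _ n (by simp only [Letter.top, topn]; omega)] at this
          simp only [valid, kapp, ite_smul, one_smul, zero_smul] at this
          simp only [hac, true_and, and_true]
          exact this
        · have hv := valid_lead (false, ⟨i, c, b', hcb⟩)
          simp only
          simp only [valid] at hv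
          rw [Mm_mkL hac, Mm_mkL hv.1, Mm_mkL hv.2]
          have f1 : c.1 ≤ c0.1 := by
            clear h1 h2 hv
            rw [← hc0]
            simp only [supp, lead, Prod.ext_iff] at *
            split_ifs at * <;> omega
          have f2 : (lead (false, ⟨i, c, b', hcb⟩)).1 ≤ d0.1 := by
            clear h1 h2 hv
            rw [← hd0]
            simp only [supp, lead, Prod.ext_iff] at *
            split_ifs at * <;> omega
          have f3 := q_lt f1 cr hne
          have f4 := q_le f2 cs
          omega
      · rw [Finset.sum_eq_zero, if_neg]
        · rintro ⟨rfl, -⟩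
          exact hcb (supp_self i c)
        · intro d hd
          rw [if_neg]
          rintro ⟨-, h3, h4⟩
          exact hcb (valid_supp_false h3 h4)
    · simp [hac]
  · intro d hd hne
    rw [mem_bx] at hd
    by_cases hac : supp (i + 1) b' d
    · by_cases hcb : supp i a d
      · have := h1 (true, ⟨i, a, d, hcb⟩) (mkL (i + 1) b' d) ?_
        · rw [← sum_box _ n (by simp only [Letter.top, topn]; omega)] at this
          simp only [valid, kapp, ite_smul, one_smul, zero_smul] at this
          simp only [hac, and_true]
          exact this
        · have hv := valid_lead (true, ⟨i, a, d, hcb⟩)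
          simp only
          simp only [valid] at hv
          rw [Mm_mkL hac, Mm_mkL hv.1, Mm_mkL hv.2]
          have f1 : d.1 ≤ d0.1 := by
            clear h1 h2 hv
            rw [← hd0]
            simp only [supp, lead, Prod.ext_iff] at *
            split_ifs at * <;> omega
          have f2 : (lead (true, ⟨i, a, d, hcb⟩)).1 ≤ c0.1 := by
            clear h1 h2 hv
            rw [← hc0]
            simp only [supp, lead, Prod.ext_iff] at *
            split_ifs at * <;> omega
          have f3 := q_lt f1 cs hne
          have f4 := q_le f2 cr
          omega
      · rw [Finset.sum_eq_zero, if_neg]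
        · rintro ⟨rfl, -⟩
          exact hcb (supp_self i a)
        · intro c hc
          rw [if_neg]
          rintro ⟨h3, h4, -⟩
          exact hcb (valid_supp_true h3 h4)
    · simp [hac]
  · rw [Finset.sum_eq_single b', Finset.sum_eq_single a]
    · simp
    · intro d _ hd
      rw [if_neg]
      exact fun h => hd h.1.symm
    · intro h; exact absurd (mem_bx.2 hn1) h
    · intro d _ hd
      rw [if_neg]
      exact fun h => hd h.1
    · intro h; exact absurd (mem_bx.2 hn4) h

def Sys (k : Type*) [Field k] : RedSys k Letter Rix J where
  C := CC
  X := XX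
  Y := YY
  ld := lead
  ld_mem r := mem_CC.2 (valid_lead r)
  kap := kapp k
  M := Mm
  M_pos l := by simp [Mm]
  lead_inj := lead_inj
  decr := decr
  hov := by
    intro F r s hrs h1 h2
    have hr := valid_lead r
    have hs := valid_lead s
    have cr := lead_col r
    have cs := lead_col s
    rcases r with ⟨_ | _, l⟩ <;> rcases s with ⟨_ | _, m⟩
    · obtain ⟨e1, e2, e3⟩ := mkL_inj hr.2 hs.1 hrs
      rw [e3, cs, ← e1] at cr
      have := congrArg Fin.val cr
      simp only [kp_val] at this
      omega
    · exact hov_ad F l m hrs h1 h2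
    · exact hov_da F l m hrs h1 h2
    · obtain ⟨e1, e2, e3⟩ := mkL_inj hr.2 hs.1 hrs
      rw [e2, cs] at cr
      have := congrArg Fin.val cr
      simp only [kp_val, e1] at this
      omega

end HopfEx

namespace HopfEx
open TensorProduct

variable (k : Type*) [Field k]

abbrev HA := (Sys k).Alg

noncomputable def mat (i : ℤ) (a b : J) : HA k :=
  if supp i a b then (Sys k).gen (mkL i a b) else 0

theorem gen_eq (l : Letter) : (Sys k).gen l = mat k l.i l.a l.b := by
  rw [mat, if_pos l.h, mkL_pos l.h]

structure Fam {B : Type*} [Ring B] [Algebra k B] (U : ℤ → J → J → B) : Prop where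
  off : ∀ {i a b}, ¬ supp i a b → U i a b = 0
  r1 : ∀ (i : ℤ) (a b : J) (n : ℕ), a.1 ≤ n → b.1 ≤ n → -i ≤ n →
    ∑ c ∈ bx n, U i a c * U (i + 1) b c = if a = b then 1 else 0
  r2 : ∀ (i : ℤ) (a b : J) (n : ℕ), a.1 ≤ n → b.1 ≤ n → -i ≤ n →
    ∑ c ∈ bx n, U (i + 1) c a * U i c b = if a = b then 1 else 0

theorem matFam : Fam k (mat k) where
  off h := if_neg h
  r1 i a b n ha hb hi := by
    by_cases h : supp i a b
    · have := (Sys k).gen_rel (false, ⟨i, a, b, h⟩)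
      change ∑ c ∈ CC (false, ⟨i, a, b, h⟩), _ = algebraMap k _ (kapp k _) at this
      rw [← sum_box _ n (by simp only [Letter.top, topn]; omega)] at this
      simp only [kapp] at this
      rw [apply_ite (algebraMap k (HA k)), map_one, map_zero] at this
      rw [← this]
      apply Finset.sum_congr rfl
      intro c _
      by_cases hv : valid (false, ⟨i, a, b, h⟩) c
      · rw [if_pos hv, mat, mat, if_pos hv.1, if_pos hv.2]
        rfl
      · rw [if_neg hv]
        simp only [valid, not_and_or] at hv
        rcases hv with hv | hv <;> simp [mat, hv]
    · rw [if_neg, Finset.sum_eq_zero]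
      · intro c _
        simp only [mat]
        split_ifs with h1 h2
        · exact absurd (valid_supp_false h1 h2) h
        all_goals simp
      · rintro rfl
        exact h (supp_self i a)
  r2 i a b n ha hb hi := by
    by_cases h : supp i a b
    · have := (Sys k).gen_rel (true, ⟨i, a, b, h⟩)
      change ∑ c ∈ CC (true, ⟨i, a, b, h⟩), _ = algebraMap k _ (kapp k _) at this
      rw [← sum_box _ n (by simp only [Letter.top, topn]; omega)] at this
      simp only [kapp] at this
      rw [apply_ite (algebraMap k (HA k)), map_one, map_zero] at this
      rw [← this]
      apply Finset.sum_congr rfl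
      intro c _
      by_cases hv : valid (true, ⟨i, a, b, h⟩) c
      · rw [if_pos hv, mat, mat, if_pos hv.1, if_pos hv.2]
        rfl
      · rw [if_neg hv]
        simp only [valid, not_and_or] at hv
        rcases hv with hv | hv <;> simp [mat, hv]
    · rw [if_neg, Finset.sum_eq_zero]
      · intro c _
        simp only [mat]
        split_ifs with h1 h2
        · exact absurd (valid_supp_true h1 h2) h
        all_goals simp
      · rintro rfl
        exact h (supp_self i a)

section
variable {k}
variable {B : Type*} [Ring B] [Algebra k B] {U : ℤ → J → J → B} (hU : Fam k U)

theorem Fam.rel (hU : Fam k U) (r : Rix) :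
    ∑ c ∈ (Sys k).C r, U ((Sys k).X r c).i ((Sys k).X r c).a ((Sys k).X r c).b *
      U ((Sys k).Y r c).i ((Sys k).Y r c).a ((Sys k).Y r c).b
      = algebraMap k _ ((Sys k).kap r) := by
  change ∑ c ∈ CC r, U (XX r c).i (XX r c).a (XX r c).b * U (YY r c).i (YY r c).a (YY r c).b
      = algebraMap k _ (kapp k r)
  rw [kapp, apply_ite (algebraMap k B), map_one, map_zero, ← sum_box r _ le_rfl]
  obtain ⟨_ | _, ⟨i, a, b, h⟩⟩ := r
  · rw [← hU.r1 i a b (Letter.top ⟨i, a, b, h⟩)]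
    · apply Finset.sum_congr rfl
      intro c _
      simp only [XX, YY]
      by_cases hh : valid (false, ⟨i, a, b, h⟩) c
      · rw [if_pos hh, mkL_pos hh.1, mkL_pos hh.2]
      · rw [if_neg hh]
        simp only [valid, not_and_or] at hh
        rcases hh with hh | hh <;> simp [hU.off hh]
    all_goals simp only [Letter.top, topn]; omega
  · rw [← hU.r2 i a b (Letter.top ⟨i, a, b, h⟩)]
    · apply Finset.sum_congr rfl
      intro c _
      simp only [XX, YY]
      by_cases hh : valid (true, ⟨i, a, b, h⟩) c
      · rw [if_pos hh, mkL_pos hh.1, mkL_pos hh.2]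
      · rw [if_neg hh]
        simp only [valid, not_and_or] at hh
        rcases hh with hh | hh <;> simp [hU.off hh]
    all_goals simp only [Letter.top, topn]; omega

noncomputable def Fam.lift : HA k →ₐ[k] B :=
  (Sys k).lift (fun l => U l.i l.a l.b) hU.rel

theorem Fam.lift_mat (i a b) : hU.lift (mat k i a b) = U i a b := by
  rw [mat]
  split_ifs with h
  · rw [Fam.lift, RedSys.lift_gen, mkL_pos h]
  · rw [map_zero, hU.off h]

end

theorem mat_ext {k : Type*} [Field k] {B : Type*} [Semiring B] [Algebra k B] {f g : HA k →ₐ[k] B} (h : ∀ i a b, f (mat k i a b) = g (mat k i a b)) : f = g := by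
  apply (Sys k).hom_ext
  intro l
  rw [gen_eq]
  exact h _ _ _

section
variable {k}
variable {B : Type*} [Ring B] [Algebra k B] {U : ℤ → J → J → B} (hU : Fam k U)
variable {D : Type*} [Ring D] [Algebra k D] {V : ℤ → J → J → D} (hV : Fam k V)

variable (U V) in
noncomputable def prodU (i : ℤ) (a b : J) : B ⊗[k] D :=
  ∑ c ∈ bx (topn i a b), U i a c ⊗ₜ[k] V i c b

theorem mid_le {i a c b} (h1 : supp i a c) (h2 : supp i c b) : c.1 ≤ topn i a b := by
  simp only [supp, topn] at *
  omega

theorem supp_trans {i a c b} (h1 : supp i a c) (h2 : supp i c b) : supp i a b := by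
  simp only [supp] at *
  omega

theorem prodU_eq (hU : Fam k U) (hV : Fam k V) {i : ℤ} {a b : J} {n : ℕ} (hn : topn i a b ≤ n) :
    (prodU U V i a b : B ⊗[k] D) = ∑ c ∈ bx n, U i a c ⊗ₜ[k] V i c b := by
  apply Finset.sum_subset
  · intro c
    rw [mem_bx, mem_bx]
    omega
  · intro c _ hc
    rw [mem_bx] at hc
    by_cases h1 : supp i a c
    · by_cases h2 : supp i c b
      · exact absurd (mid_le h1 h2) hc
      · rw [hV.off h2, tmul_zero]
    · rw [hU.off h1, zero_tmul]

theorem topn_le {i : ℤ} {a b : J} {n : ℕ} (ha : a.1 ≤ n) (hb : b.1 ≤ n) (hi : -i ≤ n) :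
    topn i a b ≤ n := by
  simp only [topn]; omega

theorem prodFam (hU : Fam k U) (hV : Fam k V) : Fam k (prodU U V : ℤ → J → J → B ⊗[k] D) where
  off {i a b} h := by
    apply Finset.sum_eq_zero
    intro c _
    by_cases h1 : supp i a c
    · by_cases h2 : supp i c b
      · exact absurd (supp_trans h1 h2) h
      · rw [hV.off h2, tmul_zero]
    · rw [hU.off h1, zero_tmul]
  r1 i a b n ha hb hi := by
    have e : ∀ c ∈ bx n, (prodU U V i a c : B ⊗[k] D) * prodU U V (i + 1) b c =
        ∑ d ∈ bx n, ∑ e ∈ bx n, (U i a d * U (i + 1) b e) ⊗ₜ[k] (V i d c * V (i + 1) e c) := by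
      intro c hc
      rw [mem_bx] at hc
      rw [prodU_eq hU hV (topn_le ha hc hi),
        prodU_eq hU hV (topn_le hb hc (by omega : -(i + 1) ≤ (n : ℤ))), Finset.sum_mul_sum]
      simp
    rw [Finset.sum_congr rfl e, Finset.sum_comm]
    rw [Finset.sum_congr rfl (g := fun d => (U i a d * U (i + 1) b d) ⊗ₜ[k] (1 : D))]
    · rw [← sum_tmul, hU.r1 i a b n ha hb hi]
      split_ifs <;> simp [Algebra.TensorProduct.one_def]
    · intro d hd
      rw [Finset.sum_comm, Finset.sum_eq_single d]
      · rw [← tmul_sum, hV.r1 i d d n (mem_bx.1 hd) (mem_bx.1 hd) hi, if_pos rfl]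
      · intro e he hne
        rw [← tmul_sum, hV.r1 i d e n (mem_bx.1 hd) (mem_bx.1 he) hi, if_neg (Ne.symm hne),
          tmul_zero]
      · intro h; exact absurd hd h
  r2 i a b n ha hb hi := by
    have e : ∀ c ∈ bx n, (prodU U V (i + 1) c a : B ⊗[k] D) * prodU U V i c b =
        ∑ d ∈ bx n, ∑ e ∈ bx n, (U (i + 1) c d * U i c e) ⊗ₜ[k] (V (i + 1) d a * V i e b) := by
      intro c hc
      rw [mem_bx] at hc
      rw [prodU_eq hU hV (topn_le hc hb hi),
        prodU_eq hU hV (topn_le hc ha (by omega : -(i + 1) ≤ (n : ℤ))), Finset.sum_mul_sum]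
      simp
    rw [Finset.sum_congr rfl e, Finset.sum_comm]
    rw [Finset.sum_congr rfl (g := fun d => (1 : B) ⊗ₜ[k] (V (i + 1) d a * V i d b))]
    · rw [← tmul_sum, hV.r2 i a b n ha hb hi]
      split_ifs <;> simp [Algebra.TensorProduct.one_def]
    · intro d hd
      rw [Finset.sum_comm, Finset.sum_eq_single d]
      · rw [← sum_tmul, hU.r2 i d d n (mem_bx.1 hd) (mem_bx.1 hd) hi, if_pos rfl]
      · intro e he hne
        rw [← sum_tmul, hU.r2 i d e n (mem_bx.1 hd) (mem_bx.1 he) hi, if_neg (Ne.symm hne),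
          zero_tmul]
      · intro h; exact absurd hd h
end

theorem sum_del {B : Type*} [Ring B] (n : ℕ) (a b : J) (ha : a.1 ≤ n) :
    ∑ c ∈ bx n, (if a = c then (1 : B) else 0) * (if b = c then 1 else 0) =
      if a = b then 1 else 0 := by
  rw [Finset.sum_eq_single a]
  · simp [eq_comm]
  · intro c _ h
    rw [if_neg h.symm, zero_mul]
  · intro h; exact absurd (mem_bx.2 ha) h

theorem sum_del2 {B : Type*} [Ring B] (n : ℕ) (a b : J) (ha : a.1 ≤ n) :
    ∑ c ∈ bx n, (if c = a then (1 : B) else 0) * (if c = b then 1 else 0) =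
      if a = b then 1 else 0 := by
  rw [Finset.sum_eq_single a]
  · simp
  · intro c _ h
    rw [if_neg h, zero_mul]
  · intro h; exact absurd (mem_bx.2 ha) h

theorem epsFam : Fam k (fun _ a b => if a = b then (1 : k) else 0) where
  off {i a b} h := by
    rw [if_neg]
    rintro rfl
    exact h (supp_self i a)
  r1 i a b n ha hb hi := sum_del n a b ha
  r2 i a b n ha hb hi := by
    exact sum_del2 n a b ha

open MulOpposite in
theorem opFam : Fam k (fun i a b => op (mat k (i + 1) b a)) where
  off {i a b} h := by
    rw [(matFam k).off, op_zero]
    intro h2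
    apply h
    simp only [supp] at *
    omega
  r1 i a b n ha hb hi := by
    have := (matFam k).r2 (i + 1) b a n hb ha (by omega)
    simp only [← op_mul]
    rw [← Finset.op_sum, this]
    simp only [eq_comm]
    split_ifs <;> simp
  r2 i a b n ha hb hi := by
    have := (matFam k).r1 (i + 1) b a n hb ha (by omega)
    simp only [← op_mul]
    rw [← Finset.op_sum, this]
    simp only [eq_comm]
    split_ifs <;> simp

noncomputable def Delta : HA k →ₐ[k] HA k ⊗[k] HA k := (prodFam (matFam k) (matFam k)).lift
noncomputable def Eps : HA k →ₐ[k] k := (epsFam k).lift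
noncomputable def Sop : HA k →ₐ[k] (HA k)ᵐᵒᵖ := (opFam k).lift

theorem Delta_mat {i a b n} (hn : topn i a b ≤ n) : Delta k (mat k i a b) =
    ∑ c ∈ bx n, mat k i a c ⊗ₜ[k] mat k i c b := by
  rw [Delta, Fam.lift_mat, prodU_eq (matFam k) (matFam k) hn]

theorem Eps_mat (i a b) : Eps k (mat k i a b) = if a = b then 1 else 0 := by
  rw [Eps, Fam.lift_mat]

theorem Sop_mat (i a b) : Sop k (mat k i a b) = MulOpposite.op (mat k (i + 1) b a) := by
  rw [Sop, Fam.lift_mat]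

theorem topn_a (i a b) : a.1 ≤ topn i a b := by simp only [topn]; omega
theorem topn_b (i a b) : b.1 ≤ topn i a b := by simp only [topn]; omega
theorem topn_i (i a b) : -i ≤ topn i a b := by simp only [topn]; omega

noncomputable instance : Bialgebra k (HA k) := Bialgebra.ofAlgHom (Delta k) (Eps k)
  (by
    apply mat_ext
    intro i a b
    simp only [AlgHom.comp_apply]
    rw [Delta_mat k le_rfl, map_sum, map_sum, map_sum]
    have e1 : ∀ c ∈ bx (topn i a b), Delta k (mat k i a c) =
        ∑ d ∈ bx (topn i a b), mat k i a d ⊗ₜ[k] mat k i d c := by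
      intro c hc
      exact Delta_mat k (topn_le (topn_a i a b) (mem_bx.1 hc) (topn_i i a b))
    have e2 : ∀ c ∈ bx (topn i a b), Delta k (mat k i c b) =
        ∑ d ∈ bx (topn i a b), mat k i c d ⊗ₜ[k] mat k i d b := by
      intro c hc
      exact Delta_mat k (topn_le (mem_bx.1 hc) (topn_b i a b) (topn_i i a b))
    simp only [Algebra.TensorProduct.map_tmul, AlgHom.coe_id, id_eq]
    conv_lhs => rw [Finset.sum_congr rfl (fun c hc => by rw [e1 c hc])]
    conv_rhs => rw [Finset.sum_congr rfl (fun c hc => by rw [e2 c hc])]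
    simp only [sum_tmul, tmul_sum, map_sum]
    rw [Finset.sum_comm]
    rfl)
  (by
    apply mat_ext
    intro i a b
    simp only [AlgHom.comp_apply]
    rw [Delta_mat k le_rfl, map_sum, Finset.sum_eq_single a]
    · simp [Eps_mat]
    · intro c _ h
      simp [Eps_mat, h.symm]
    · intro h; exact absurd (mem_bx.2 (topn_a i a b)) h)
  (by
    apply mat_ext
    intro i a b
    simp only [AlgHom.comp_apply]
    rw [Delta_mat k le_rfl, map_sum, Finset.sum_eq_single b]
    · simp [Eps_mat]
    · intro c _ h
      simp [Eps_mat, h]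
    · intro h; exact absurd (mem_bx.2 (topn_b i a b)) h)

theorem comul_eq (x : HA k) : Coalgebra.comul (R := k) x = Delta k x := rfl
theorem counit_eq (x : HA k) : Coalgebra.counit (R := k) x = Eps k x := rfl

noncomputable def Sl : HA k →ₗ[k] HA k :=
  (MulOpposite.opLinearEquiv k).symm.toLinearMap ∘ₗ (Sop k).toLinearMap

theorem Sl_mul (x y) : Sl k (x * y) = Sl k y * Sl k x := by simp [Sl]
theorem Sl_one : Sl k 1 = 1 := by simp [Sl]
theorem Sl_mat (i a b) : Sl k (mat k i a b) = mat k (i + 1) b a := by simp [Sl, Sop_mat]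

noncomputable instance : HopfAlgebraStruct k (HA k) := { antipode := Sl k }

theorem Phi1 (X : HA k ⊗[k] HA k) (s t : HA k) :
    LinearMap.mul' k _ ((Sl k).rTensor _ (X * s ⊗ₜ t)) =
      Sl k s * LinearMap.mul' k _ ((Sl k).rTensor _ X) * t := by
  induction X with
  | zero => simp
  | add x y hx hy => rw [add_mul, map_add, map_add, hx, hy, map_add, map_add, mul_add, add_mul]
  | tmul x y => simp [Sl_mul, mul_assoc]

theorem Phi2 (X : HA k ⊗[k] HA k) (s t : HA k) :
    LinearMap.mul' k _ ((Sl k).lTensor _ (s ⊗ₜ t * X)) =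
      s * LinearMap.mul' k _ ((Sl k).lTensor _ X) * Sl k t := by
  induction X with
  | zero => simp
  | add x y hx hy => rw [mul_add, map_add, map_add, hx, hy, map_add, map_add, mul_add, add_mul]
  | tmul x y => simp [Sl_mul, mul_assoc]

theorem anti1 (x : HA k) : LinearMap.mul' k _ ((Sl k).rTensor _ (Delta k x)) =
    algebraMap k _ (Eps k x) := by
  induction x using (Sys k).gen_induction with
  | h1 a => simp [Algebra.TensorProduct.one_def, Algebra.algebraMap_eq_smul_one, Sl_one]
  | h2 x y hx hy => simp only [map_add, hx, hy]
  | h3 x y hx hy =>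
    rw [map_mul (Delta k), map_mul (Eps k), map_mul (algebraMap k _), ← hy]
    generalize Delta k y = T
    induction T with
    | zero => simp
    | add s t hs ht => rw [mul_add, map_add, map_add, hs, ht, map_add, map_add, mul_add]
    | tmul s t =>
      rw [Phi1, hx, ← Algebra.commutes]
      simp [mul_assoc]
  | h4 l =>
    rw [gen_eq, Delta_mat k le_rfl, map_sum, map_sum, Eps_mat]
    simp only [LinearMap.rTensor_tmul, LinearMap.mul'_apply, Sl_mat]
    rw [(matFam k).r2 l.i l.a l.b _ (topn_a ..) (topn_b ..) (topn_i ..)]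
    split_ifs <;> simp

theorem anti2 (x : HA k) : LinearMap.mul' k _ ((Sl k).lTensor _ (Delta k x)) =
    algebraMap k _ (Eps k x) := by
  induction x using (Sys k).gen_induction with
  | h1 a => simp [Algebra.TensorProduct.one_def, Algebra.algebraMap_eq_smul_one, Sl_one]
  | h2 x y hx hy => simp only [map_add, hx, hy]
  | h3 x y hx hy =>
    rw [map_mul (Delta k), map_mul (Eps k), map_mul (algebraMap k _), ← hx]
    generalize Delta k x = T
    induction T with
    | zero => simp
    | add s t hs ht => rw [add_mul, map_add, map_add, hs, ht, map_add, map_add, add_mul]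
    | tmul s t =>
      rw [Phi2, hy, ← Algebra.commutes]
      simp [mul_assoc, Algebra.commutes]
  | h4 l =>
    rw [gen_eq, Delta_mat k le_rfl, map_sum, map_sum, Eps_mat]
    simp only [LinearMap.lTensor_tmul, LinearMap.mul'_apply, Sl_mat]
    rw [(matFam k).r1 l.i l.a l.b _ (topn_a ..) (topn_b ..) (topn_i ..)]
    split_ifs <;> simp

noncomputable instance : HopfAlgebra k (HA k) where
  mul_antipode_rTensor_comul := by
    ext x
    exact anti1 k x
  mul_antipode_lTensor_comul := by
    ext x
    exact anti2 k x

theorem antipode_eq (x : HA k) : HopfAlgebra.antipode k x = Sl k x := rfl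

theorem Sl_surj : Function.Surjective (Sl k) := by
  intro x
  change x ∈ LinearMap.range (Sl k)
  induction x using (Sys k).gen_induction with
  | h1 a => exact ⟨algebraMap k _ a, by simp [Algebra.algebraMap_eq_smul_one, Sl_one]⟩
  | h2 x y hx hy => exact Submodule.add_mem _ hx hy
  | h3 x y hx hy =>
    obtain ⟨x, rfl⟩ := hx
    obtain ⟨y, rfl⟩ := hy
    exact ⟨y * x, Sl_mul ..⟩
  | h4 l => exact ⟨mat k (l.i - 1) l.b l.a, by rw [Sl_mat, gen_eq, sub_add_cancel]⟩

theorem not_bad_of_short (w : List Letter) (h : w.length ≤ 1) : ¬ (Sys k).Bad w := by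
  rintro ⟨r, α, β, rfl⟩
  simp at h
  omega

theorem Sl_not_inj : ¬ Function.Injective (Sl k) := by
  intro h
  have hs : supp (-2) (2, 0) (0, 0) := by simp [supp]
  have e : mat k (-2) (2, 0) (0, 0) = 0 := by
    apply h
    rw [Sl_mat, map_zero, (matFam k).off]
    simp [supp]
  have e2 := (Sys k).NF_wd [mkL (-2) (2, 0) (0, 0)]
  rw [(Sys k).N_normal _ (not_bad_of_short k _ (by simp)), (Sys k).wd_cons, (Sys k).wd_nil,
    mul_one] at e2
  rw [mat, if_pos hs] at e
  rw [e, map_zero] at e2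
  have := congrArg (fun v => v [mkL (-2) (2, 0) (0, 0)]) e2
  simp at this

end HopfEx

namespace HopfEx
open TensorProduct Coalgebra HopfAlgebra WithConv

section gen
variable {k : Type*} [Field k] {A : Type*} [Ring A] [HopfAlgebra k A]
variable {B : Type*} [Ring B] [HopfAlgebra k B]

theorem hom_antipode (f : A →ₐc[k] B) (x : A) : f (antipode k x) = antipode k (f x) := by
  let F : A →ₗ[k] B := (f : A →ₗ[k] B)
  have h1 : toConv (F ∘ₗ antipode k) * toConv F = 1 := by
    ext x
    have := congrArg f (mul_antipode_rTensor_comul_apply (R := k) x)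
    simp only [LinearMap.convMul_def, LinearMap.convOne_def]
    simp only [LinearMap.comp_apply]
    have e : ∀ T : A ⊗[k] A, LinearMap.mul' k B (TensorProduct.map (F ∘ₗ antipode k) F T) =
        f (LinearMap.mul' k A ((antipode k).rTensor A T)) := by
      intro T
      induction T with
      | zero => simp
      | add s t hs ht => simp only [map_add, hs, ht]
      | tmul s t => simp [F]
    refine (e _).trans (this.trans ?_)
    simp only [LinearMap.comp_apply, Algebra.linearMap_apply]
    exact AlgHomClass.commutes (f : A →ₐ[k] B) _
  have h2 : toConv F * toConv (antipode k ∘ₗ F) = 1 := by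
    ext x
    have := mul_antipode_lTensor_comul_apply (R := k) (f x)
    simp only [LinearMap.convMul_def, LinearMap.convOne_def]
    simp only [LinearMap.comp_apply]
    have e : ∀ T : A ⊗[k] A, LinearMap.mul' k B (TensorProduct.map F (antipode k ∘ₗ F) T) =
        LinearMap.mul' k B ((antipode k).lTensor B (TensorProduct.map F F T)) := by
      intro T
      induction T with
      | zero => simp
      | add s t hs ht => simp only [map_add, hs, ht]
      | tmul s t => simp [F]
    have e2 : TensorProduct.map F F (comul x) = comul (R := k) (f x) :=
      CoalgHomClass.map_comp_comul_apply f x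
    refine (e _).trans ?_
    rw [e2, this]
    simp
  have := left_inv_eq_right_inv h1 h2
  have := congrArg WithConv.ofConv this
  exact LinearMap.congr_fun this x

noncomputable def mS : A ⊗[k] A →ₗ[k] A := LinearMap.mul' k A ∘ₗ (antipode k).lTensor A

noncomputable def L4 : A ⊗[k] (A ⊗[k] (A ⊗[k] A)) →ₗ[k] A ⊗[k] A :=
  TensorProduct.map mS mS ∘ₗ (TensorProduct.assoc k A A (A ⊗[k] A)).symm.toLinearMap ∘ₗ
    (((TensorProduct.comm k (A ⊗[k] A) A).toLinearMap ∘ₗ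
      (TensorProduct.assoc k A A A).symm.toLinearMap).lTensor A)

@[simp] theorem L4_tmul (x y z w : A) : L4 (k := k) (x ⊗ₜ (y ⊗ₜ (z ⊗ₜ w))) =
    (x * antipode k w) ⊗ₜ[k] (y * antipode k z) := by
  simp [L4, mS]

noncomputable def L3 : A ⊗[k] (A ⊗[k] A) →ₗ[k] A ⊗[k] A :=
  (Algebra.TensorProduct.includeLeft : A →ₐ[k] A ⊗[k] A).toLinearMap ∘ₗ mS ∘ₗ
    ((TensorProduct.lid k A).toLinearMap ∘ₗ (counit (R := k) (A := A)).rTensor A).lTensor A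

theorem L3_tmul (x y z : A) : L3 (k := k) (x ⊗ₜ (y ⊗ₜ z)) =
    counit (R := k) y • ((x * antipode k z) ⊗ₜ[k] (1 : A)) := by
  simp [L3, mS, smul_tmul']

variable (k A) in
noncomputable def Gm : A →ₗ[k] A ⊗[k] A :=
  TensorProduct.map (antipode k) (antipode k) ∘ₗ (TensorProduct.comm k A A).toLinearMap ∘ₗ comul

theorem step1 (t : A ⊗[k] A) : LinearMap.mul' k (A ⊗[k] A) (TensorProduct.map comul (Gm k A) t) =
    L4 (k := k) ((comul.lTensor A).lTensor A (TensorProduct.assoc k A A A (comul.rTensor A t))) := by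
  induction t with
  | zero => simp
  | add s t hs ht => simp only [map_add, hs, ht]
  | tmul a b =>
    simp only [TensorProduct.map_tmul, LinearMap.rTensor_tmul, LinearMap.mul'_apply, Gm,
      LinearMap.comp_apply, LinearEquiv.coe_coe]
    generalize comul (R := k) a = s
    induction s with
    | zero => simp
    | add s t hs ht => simp only [map_add, hs, ht, add_mul, add_tmul]
    | tmul x y =>
      simp only [assoc_tmul, LinearMap.lTensor_tmul]
      generalize comul (R := k) b = s
      induction s with
      | zero => simp
      | add s t hs ht => simp only [map_add, hs, ht, mul_add, tmul_add]
      | tmul z w => simp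

theorem step2 (t : A ⊗[k] A) :
    L4 (k := k) ((comul.lTensor A).lTensor A (comul.lTensor A t)) =
    L4 (k := k) (((TensorProduct.assoc k A A A).toLinearMap ∘ₗ comul.rTensor A).lTensor A
      (comul.lTensor A t)) := by
  induction t with
  | zero => simp
  | add s t hs ht => simp only [map_add, hs, ht]
  | tmul a b =>
    simp only [LinearMap.lTensor_tmul, LinearMap.comp_apply, LinearEquiv.coe_coe]
    rw [coassoc_apply]

theorem step3 (t : A ⊗[k] (A ⊗[k] A)) :
    L4 (k := k) (((TensorProduct.assoc k A A A).toLinearMap ∘ₗ comul.rTensor A).lTensor A t) =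
    L3 (k := k) t := by
  induction t with
  | zero => simp
  | add s t hs ht => simp only [map_add, hs, ht]
  | tmul a b =>
    induction b with
    | zero => simp
    | add s t hs ht => simp only [map_add, tmul_add, hs, ht]
    | tmul y z =>
      have h := mul_antipode_lTensor_comul_apply (R := k) y
      rw [L3_tmul]
      simp only [LinearMap.lTensor_tmul, LinearMap.comp_apply, LinearEquiv.coe_coe,
        LinearMap.rTensor_tmul]
      have e : ∀ T : A ⊗[k] A, L4 (k := k) (a ⊗ₜ[k] (TensorProduct.assoc k A A A) (T ⊗ₜ[k] z)) =
        (a * antipode k z) ⊗ₜ[k] LinearMap.mul' k A ((antipode k).lTensor A T) := by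
        intro T
        induction T with
        | zero => simp
        | add s t hs ht => simp only [map_add, tmul_add, add_tmul, hs, ht]
        | tmul s t => simp
      rw [e, h, Algebra.algebraMap_eq_smul_one, tmul_smul]

theorem step4 (x : A) : L3 (k := k) (comul.lTensor A (comul x)) =
    algebraMap k (A ⊗[k] A) (counit x) := by
  have h := mul_antipode_lTensor_comul_apply (R := k) x
  have e : ∀ t : A ⊗[k] A, L3 (k := k) (comul.lTensor A t) =
      (LinearMap.mul' k A ((antipode k).lTensor A t)) ⊗ₜ[k] (1 : A) := by
    intro t
    induction t with
    | zero => simp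
    | add s t hs ht => simp only [map_add, add_tmul, hs, ht]
    | tmul a b =>
      have := rTensor_counit_comul (R := k) b
      simp only [L3, LinearMap.comp_apply, LinearMap.lTensor_tmul, LinearEquiv.coe_coe, this]
      simp [mS]
  rw [e, h, Algebra.TensorProduct.algebraMap_apply]

theorem comul_antipode (x : A) : comul (R := k) (antipode k x) = Gm k A x := by
  have h1 : toConv ((comul (R := k) (A := A)) ∘ₗ antipode k) * toConv (comul (R := k) (A := A)) = 1 := by
    ext x
    have := congrArg (comul (R := k)) (mul_antipode_rTensor_comul_apply (R := k) x)
    simp only [LinearMap.convMul_def, LinearMap.convOne_def]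
    simp only [LinearMap.comp_apply]
    have e : ∀ T : A ⊗[k] A, LinearMap.mul' k (A ⊗[k] A)
        (TensorProduct.map ((comul (R := k) (A := A)) ∘ₗ antipode k) comul T) =
        comul (R := k) (LinearMap.mul' k A ((antipode k).rTensor A T)) := by
      intro T
      induction T with
      | zero => simp
      | add s t hs ht => simp only [map_add, hs, ht]
      | tmul s t => simp
    refine (e _).trans (this.trans ?_)
    simp
  have h2 : toConv (comul (R := k) (A := A)) * toConv (Gm k A) = 1 := by
    ext x
    simp only [LinearMap.convMul_def, LinearMap.convOne_def]
    simp only [LinearMap.comp_apply]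
    refine (step1 _).trans ?_
    rw [coassoc_apply, step2, step3, step4]
    rfl
  have := left_inv_eq_right_inv h1 h2
  have := congrArg WithConv.ofConv this
  exact LinearMap.congr_fun this x

theorem comul_antipode_sq (x : A) : comul (R := k) (antipode k (antipode k x)) =
    TensorProduct.map (antipode k ∘ₗ antipode k) (antipode k ∘ₗ antipode k)
      (comul (R := k) x) := by
  rw [comul_antipode, Gm, LinearMap.comp_apply, LinearMap.comp_apply, comul_antipode, Gm,
    LinearMap.comp_apply, LinearMap.comp_apply]
  generalize comul (R := k) x = T
  induction T with
  | zero => simp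
  | add s t hs ht => simp only [map_add, hs, ht]
  | tmul s t => simp

end gen

end HopfEx

namespace HopfEx
open TensorProduct

variable (k : Type*) [Field k]

abbrev GJ := FreeGroup J
abbrev KG := MonoidAlgebra k GJ

def par (i : ℤ) : Bool := decide (i % 2 = 0)

theorem par_succ (i : ℤ) : par (i + 1) = !par i := by
  by_cases h : i % 2 = 0
  · have : ¬ (i + 1) % 2 = 0 := by omega
    simp [par, h, this]
  · have : (i + 1) % 2 = 0 := by omega
    simp [par, h, this]

def gp (i : ℤ) (a : J) : GJ := FreeGroup.mk [(a, par i)]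

theorem gp_inv (i a) : (gp i a)⁻¹ = gp (i + 1) a := by
  simp [gp, FreeGroup.inv_mk, FreeGroup.invRev, par_succ]

theorem gp_mul (i a) : gp i a * gp (i + 1) a = 1 := by
  rw [← gp_inv, mul_inv_cancel]

theorem gp_mul2 (i a) : gp (i + 1) a * gp i a = 1 := by
  rw [← gp_inv, inv_mul_cancel]

theorem piFam : Fam k (fun i a b => if a = b then (MonoidAlgebra.single (gp i a) 1 : KG k) else 0) where
  off {i a b} h := by
    rw [if_neg]
    rintro rfl
    exact h (supp_self i a)
  r1 i a b n ha hb hi := by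
    rw [Finset.sum_eq_single a]
    · by_cases h : a = b
      · subst h
        simp [MonoidAlgebra.single_mul_single, gp_mul, MonoidAlgebra.one_def]
      · simp [h, Ne.symm h]
    · intro c _ h
      rw [if_neg h.symm, zero_mul]
    · intro h; exact absurd (mem_bx.2 ha) h
  r2 i a b n ha hb hi := by
    rw [Finset.sum_eq_single a]
    · by_cases h : a = b
      · subst h
        simp [MonoidAlgebra.single_mul_single, gp_mul2, MonoidAlgebra.one_def]
      · simp [h]
    · intro c _ h
      rw [if_neg h, zero_mul]
    · intro h; exact absurd (mem_bx.2 ha) h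

noncomputable def Pi : HA k →ₐ[k] KG k := (piFam k).lift

theorem Pi_mat (i a b) : Pi k (mat k i a b) =
    if a = b then (MonoidAlgebra.single (gp i a) 1 : KG k) else 0 := by
  rw [Pi, Fam.lift_mat]

noncomputable def S2 : HA k →ₐ[k] HA k :=
  AlgHom.ofLinearMap (Sl k ∘ₗ Sl k) (by simp [Sl_one]) (by intro x y; simp [Sl_mul])

theorem S2_apply (x) : S2 k x = Sl k (Sl k x) := rfl
theorem S2_mat (i a b) : S2 k (mat k i a b) = mat k (i + 2) a b := by
  rw [S2_apply, Sl_mat, Sl_mat, add_assoc]; rfl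

theorem Pi_S2 (x) : Pi k (S2 k x) = Pi k x := by
  have : (Pi k).comp (S2 k) = Pi k := by
    apply mat_ext
    intro i a b
    have : par (i + 2) = par i := by
      rw [show i + 2 = i + 1 + 1 by ring, par_succ, par_succ, Bool.not_not]
    simp [Pi_mat, S2_mat, gp, this]
  exact DFunLike.congr_fun this x

/-- the triple tensor product, sealed to keep instance search simple -/
def T3 : Type _ := HA k ⊗[k] (KG k ⊗[k] HA k)

noncomputable instance : Ring (T3 k) := inferInstanceAs (Ring (HA k ⊗[k] (KG k ⊗[k] HA k)))
noncomputable instance : Algebra k (T3 k) :=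
  inferInstanceAs (Algebra k (HA k ⊗[k] (KG k ⊗[k] HA k)))

/-- pure tensors -/
noncomputable def t3 (x : HA k) (p : KG k) (y : HA k) : T3 k :=
  (x ⊗ₜ[k] (p ⊗ₜ[k] y) : HA k ⊗[k] (KG k ⊗[k] HA k))

/-- the identification -/
noncomputable def T3.toE : T3 k ≃ₗ[k] HA k ⊗[k] (KG k ⊗[k] HA k) := LinearEquiv.refl k _

theorem T3.toE_t3 (x p y) : T3.toE k (t3 k x p y) = x ⊗ₜ[k] (p ⊗ₜ[k] y) := rfl

theorem t3_mul (x p y x₂ p₂ y₂) :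
    t3 k x p y * t3 k x₂ p₂ y₂ = t3 k (x * x₂) (p * p₂) (y * y₂) := by
  have h1 := Algebra.TensorProduct.tmul_mul_tmul (R := k) x x₂ (p ⊗ₜ[k] y) (p₂ ⊗ₜ[k] y₂)
  have h2 := Algebra.TensorProduct.tmul_mul_tmul (R := k) p p₂ y y₂
  rw [h2] at h1
  exact h1

theorem t3_one : (1 : T3 k) = t3 k 1 1 1 := rfl

theorem T3.ind {P : T3 k → Prop} (z : T3 k) (h0 : P 0) (h1 : ∀ x p y, P (t3 k x p y))
    (h2 : ∀ a b, P a → P b → P (a + b)) : P z := by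
  refine TensorProduct.induction_on (motive := fun z => P z) z h0 ?_ h2
  intro x t
  refine TensorProduct.induction_on (motive := fun t => P (x ⊗ₜ[k] t : HA k ⊗[k] (KG k ⊗[k] HA k))) t ?_ ?_ ?_
  · rw [tmul_zero]; exact h0
  · intro p y; exact h1 x p y
  · intro a b ha hb; rw [tmul_add]; exact h2 _ _ ha hb

noncomputable def Psi : HA k →ₐ[k] T3 k :=
  ((Algebra.TensorProduct.map (AlgHom.id k _) (Algebra.TensorProduct.map (Pi k) (AlgHom.id k _))).comp
    ((Algebra.TensorProduct.map (AlgHom.id k _) (Delta k)).comp (Delta k)) :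
    HA k →ₐ[k] HA k ⊗[k] (KG k ⊗[k] HA k))

/-- `Psi` in linear terms -/
theorem Psi_lin (x : HA k) : T3.toE k (Psi k x) =
    TensorProduct.map LinearMap.id (TensorProduct.map (Pi k).toLinearMap LinearMap.id)
      (TensorProduct.map LinearMap.id (Delta k).toLinearMap (Delta k x)) := rfl

theorem Psi_mat {i a b n} (hn : topn i a b ≤ n) : Psi k (mat k i a b) =
    ∑ c ∈ bx n, t3 k (mat k i a c) (MonoidAlgebra.single (gp i c) 1) (mat k i c b) := by
  apply (T3.toE k).injective
  rw [Psi_lin, Delta_mat k hn, map_sum, map_sum, map_sum]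
  apply Finset.sum_congr rfl
  intro c hc
  have h1 : topn i c b ≤ n := by
    rw [mem_bx] at hc
    simp only [topn] at *
    omega
  simp only [TensorProduct.map_tmul, LinearMap.id_coe, id_eq, T3.toE_t3, AlgHom.toLinearMap_apply]
  rw [Delta_mat k h1, map_sum, Finset.sum_eq_single c]
  · simp [Pi_mat]
  · intro d _ h
    simp [Pi_mat, h.symm]
  · intro h; exact absurd hc h

noncomputable def cof (τ : GJ) : KG k →ₗ[k] k where
  toFun x := x.coeff τ
  map_add' x y := by simp
  map_smul' x y := by simp

noncomputable def cf (τ : GJ) : T3 k →ₗ[k] HA k ⊗[k] HA k :=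
  LinearMap.lTensor _ ((TensorProduct.lid k _).toLinearMap ∘ₗ LinearMap.rTensor _ (cof k τ)) ∘ₗ
    (T3.toE k).toLinearMap

theorem cof_apply (τ p) : cof k τ p = p.coeff τ := rfl

theorem cf_t3 (τ x p y) : cf k τ (t3 k x p y) = (p.coeff τ) • (x ⊗ₜ[k] y) := by
  simp [cf, cof_apply, T3.toE_t3]

theorem cf_mul (τ : GJ) (g : GJ) (x y) (Z : T3 k) :
    cf k τ (t3 k x (MonoidAlgebra.single g 1) y * Z) =
      (x ⊗ₜ[k] y) * cf k (g⁻¹ * τ) Z := by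
  induction Z using T3.ind with
  | h0 => simp only [mul_zero, map_zero]
  | h2 s t hs ht => rw [mul_add, map_add, map_add, hs, ht, mul_add]
  | h1 s u v =>
    rw [t3_mul, cf_t3, cf_t3, MonoidAlgebra.coeff_single_mul_apply, one_mul, mul_smul_comm,
      Algebra.TensorProduct.tmul_mul_tmul]

theorem cf_one (τ : GJ) : cf k τ 1 = if τ = 1 then 1 else 0 := by
  rw [t3_one, cf_t3, MonoidAlgebra.one_def,
    MonoidAlgebra.coeff_single, Finsupp.single_apply]
  simp only [eq_comm (a := τ)]
  split_ifs <;> simp [Algebra.TensorProduct.one_def]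

theorem cf_cons (τ : GJ) (l : Letter) (w : List Letter) :
    cf k τ (Psi k ((Sys k).wd (l :: w))) = ∑ c ∈ bx l.top,
      (mat k l.i l.a c ⊗ₜ[k] mat k l.i c l.b) * cf k (gp (l.i + 1) c * τ) (Psi k ((Sys k).wd w)) := by
  rw [(Sys k).wd_cons, map_mul, gen_eq, Psi_mat k le_rfl, Finset.sum_mul, map_sum]
  apply Finset.sum_congr rfl
  intro c _
  rw [cf_mul, gp_inv]

theorem gp_mk (i c L) : gp (i + 1) c * FreeGroup.mk L = FreeGroup.mk ((c, !par i) :: L) := by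
  rw [gp, FreeGroup.mul_mk, par_succ]; rfl

theorem gp_mk_cancel (i c L) : gp (i + 1) c * FreeGroup.mk ((c, par i) :: L) = FreeGroup.mk L := by
  have : FreeGroup.mk ((c, par i) :: L) = gp i c * FreeGroup.mk L := by
    rw [gp, FreeGroup.mul_mk]; rfl
  rw [this, ← mul_assoc, gp_mul2, one_mul]

theorem claimA (w : List Letter) : ∀ L : List (J × Bool), FreeGroup.IsReduced L →
    w.length < L.length → cf k (FreeGroup.mk L) (Psi k ((Sys k).wd w)) = 0 := by
  induction w with
  | nil =>
    intro L hL h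
    rw [(Sys k).wd_nil, map_one, cf_one, if_neg]
    intro e
    rw [FreeGroup.one_eq_mk] at e
    have := congrArg FreeGroup.toWord e
    rw [FreeGroup.toWord_mk, FreeGroup.toWord_mk, hL.reduce_eq] at this
    simp at this
    subst this
    simp at h
  | cons l w ih =>
    intro L hL h
    rw [cf_cons]
    apply Finset.sum_eq_zero
    intro c _
    cases L with
    | nil => simp at h
    | cons p L =>
      obtain ⟨c0, e0⟩ := p
      by_cases hp : c = c0 ∧ e0 = par l.i
      · obtain ⟨rfl, rfl⟩ := hp
        rw [gp_mk_cancel, ih, mul_zero]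
        · exact hL.infix (List.suffix_cons _ _).isInfix
        · simpa using h
      · rw [gp_mk, ih, mul_zero]
        · rw [FreeGroup.isReduced_cons_cons]
          refine ⟨?_, hL⟩
          intro hc
          simp only at hc
          have : e0 ≠ par l.i := fun h => hp ⟨hc, h⟩
          cases e0 <;> cases h : par l.i <;> simp_all
        · simp at h ⊢; omega

theorem claimB (l : Letter) (w : List Letter) (c0 : J) (e0 : Bool) (L : List (J × Bool))
    (hL : FreeGroup.IsReduced ((c0, e0) :: L)) (h : w.length = L.length) :
    cf k (FreeGroup.mk ((c0, e0) :: L)) (Psi k ((Sys k).wd (l :: w))) =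
      if e0 = par l.i then (mat k l.i l.a c0 ⊗ₜ[k] mat k l.i c0 l.b) *
        cf k (FreeGroup.mk L) (Psi k ((Sys k).wd w)) else 0 := by
  have key : ∀ c, ¬ (c = c0 ∧ e0 = par l.i) →
      (mat k l.i l.a c ⊗ₜ[k] mat k l.i c l.b) *
        cf k (gp (l.i + 1) c * FreeGroup.mk ((c0, e0) :: L)) (Psi k ((Sys k).wd w)) = 0 := by
    intro c hp
    rw [gp_mk, claimA, mul_zero]
    · rw [FreeGroup.isReduced_cons_cons]
      refine ⟨?_, hL⟩
      intro hc
      simp only at hc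
      have : e0 ≠ par l.i := fun h => hp ⟨hc, h⟩
      cases e0 <;> cases h : par l.i <;> simp_all
    · simp; omega
  rw [cf_cons]
  split_ifs with he
  · subst he
    rw [Finset.sum_eq_single c0]
    · rw [gp_mk_cancel]
    · intro c _ h
      exact key c (fun hh => h hh.1)
    · intro hc
      rw [mem_bx] at hc
      by_cases h1 : supp l.i l.a c0
      · by_cases h2 : supp l.i c0 l.b
        · exact absurd (mid_le h1 h2) hc
        · rw [(matFam k).off h2, tmul_zero, zero_mul]
      · rw [(matFam k).off h1, zero_tmul, zero_mul]
  · apply Finset.sum_eq_zero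
    intro c _
    exact key c (fun hh => he hh.2)

end HopfEx

namespace HopfEx
open TensorProduct

variable (k : Type*) [Field k]

def col (b : Bool) : Fin 5 := if b then 3 else 4

theorem col_val (b : Bool) : 3 ≤ (col b).val := by cases b <;> simp [col]

def mkl : Bool → List Letter → List (J × Bool)
  | _, [] => []
  | b, l :: w => ((l.top, col b), par l.i) :: mkl (!b) w

theorem mkl_length (b w) : (mkl b w).length = w.length := by
  induction w generalizing b with
  | nil => rfl
  | cons l w ih => simp [mkl, ih]

theorem mkl_red (b w) : FreeGroup.IsReduced (mkl b w) := by
  induction w generalizing b with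
  | nil => simp [mkl]
  | cons l w ih =>
    cases w with
    | nil => simp [mkl]
    | cons l' w =>
      have := ih (!b)
      rw [mkl] at this
      rw [mkl, mkl, FreeGroup.isReduced_cons_cons]
      refine ⟨?_, this⟩
      intro h
      exfalso
      have := congrArg (fun c : J => c.2) h
      cases b <;> simp [col] at this

def wlf (b : Bool) (l : Letter) : Letter := mkL l.i l.a (l.top, col b)
def wrf (b : Bool) (l : Letter) : Letter := mkL l.i (l.top, col b) l.b

theorem supp_l (l : Letter) (b : Fin 5) : supp l.i l.a (l.top, b) := by
  have := l.h
  simp only [supp, Letter.top, topn] at *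
  omega

theorem supp_r (l : Letter) (b : Fin 5) : supp l.i (l.top, b) l.b := by
  have := l.h
  simp only [supp, Letter.top, topn] at *
  omega

def wl : Bool → List Letter → List Letter
  | _, [] => []
  | b, l :: w => wlf b l :: wl (!b) w

def wr : Bool → List Letter → List Letter
  | _, [] => []
  | b, l :: w => wrf b l :: wr (!b) w

def st (w : List Letter) : ℕ := (w.map Letter.top).sum

theorem C1 (w0 : List Letter) : ∀ (b : Bool) (w : List Letter), w.length = w0.length →
    cf k (FreeGroup.mk (mkl b w0)) (Psi k ((Sys k).wd w)) = 0 ∨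
      (st w0 ≤ st w ∧ (st w ≤ st w0 → mkl b w = mkl b w0)) := by
  induction w0 with
  | nil =>
    intro b w h
    right
    have : w = [] := by simpa using h
    subst this
    simp
  | cons l0 w0 ih =>
    intro b w h
    cases w with
    | nil => simp at h
    | cons l w =>
      have hw : w.length = w0.length := by simpa using h
      rw [mkl, claimB k _ _ _ _ _ (mkl_red b (l0 :: w0)) (by rw [mkl_length, hw])]
      split_ifs with he
      · rcases ih (!b) w hw with h0 | ⟨h1, h2⟩
        · left; rw [h0, mul_zero]
        by_cases hs1 : supp l.i l.a (l0.top, col b)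
        · by_cases hs2 : supp l.i (l0.top, col b) l.b
          · have := mid_le hs1 hs2
            change l0.top ≤ l.top at this
            right
            simp only [st, List.map_cons, List.sum_cons] at *
            refine ⟨by omega, fun hh => ?_⟩
            rw [mkl, h2 (by omega), he, show l.top = l0.top by omega]
          · left
            rw [(matFam k).off hs2, tmul_zero, zero_mul]
        · left
          rw [(matFam k).off hs1, zero_tmul, zero_mul]
      · left; rfl

theorem C2 (b : Bool) (w : List Letter) : cf k (FreeGroup.mk (mkl b w)) (Psi k ((Sys k).wd w)) =
    (Sys k).wd (wl b w) ⊗ₜ[k] (Sys k).wd (wr b w) := by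
  induction w generalizing b with
  | nil =>
    simp only [mkl, wl, wr]
    rw [(Sys k).wd_nil, map_one, cf_one, if_pos FreeGroup.one_eq_mk.symm,
      Algebra.TensorProduct.one_def]
  | cons l w ih =>
    have hr := mkl_red b (l :: w)
    rw [mkl] at hr
    rw [mkl, claimB k _ _ _ _ _ hr (by rw [mkl_length]), if_pos rfl, ih, wl, wr,
      (Sys k).wd_cons, (Sys k).wd_cons, Algebra.TensorProduct.tmul_mul_tmul, mat, mat,
      if_pos (supp_l _ _), if_pos (supp_r _ _)]
    rfl

def Bp (l1 l2 : Letter) : Prop := ∃ r, l1 = XX r (lead r) ∧ l2 = YY r (lead r)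

theorem bad_iff (w : List Letter) :
    (Sys k).Bad w ↔ ∃ x y α β, w = α ++ x :: y :: β ∧ Bp x y := by
  constructor
  · rintro ⟨r, α, β, rfl⟩
    exact ⟨_, _, α, β, rfl, r, rfl, rfl⟩
  · rintro ⟨x, y, α, β, rfl, r, rfl, rfl⟩
    exact ⟨r, α, β, rfl⟩

theorem col_ne_kp (b : Bool) (i : ℤ) : col b ≠ kp i := by
  intro h
  have := col_val b
  rw [h, kp_val] at this
  omega

theorem Bp_l {b b' : Bool} {l1 l2 : Letter} (h : Bp (wlf b l1) (wlf b' l2)) : Bp l1 l2 := by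
  obtain ⟨r, h1, h2⟩ := h
  have hv := valid_lead r
  have hc := lead_col r
  rcases r with ⟨_ | _, ⟨i, a, c, h⟩⟩
  · have := (mkL_inj (supp_l l1 _) hv.1 h1).2.2
    rw [← this] at hc
    exact absurd hc (col_ne_kp _ _)
  · obtain ⟨e1, e2, e3⟩ := mkL_inj (supp_l l1 _) hv.1 h1
    obtain ⟨f1, f2, f3⟩ := mkL_inj (supp_l l2 _) hv.2 h2
    subst e3 f3
    obtain ⟨i1, a1, b1, s1⟩ := l1
    obtain ⟨i2, a2, b2, s2⟩ := l2
    simp only at e1 e2 f1 f2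
    subst e1 f1
    have e4 : a1 = a2 := e2.trans f2.symm
    have g1 := congrArg Prod.fst f2
    have g2 := f2.symm ▸ lead_col _
    clear h1 h2 hv hc e2 f2
    subst e4
    have s3 : supp i2 b1 b2 := valid_supp_true s1 s2
    have hl : lead (true, ⟨i2, b1, b2, s3⟩) = a1 := by
      have t1 := s1
      have t2 := s2
      simp only [supp] at t1 t2
      simp only [lead, Letter.top, topn] at *
      apply Prod.ext
      · simp only
        split_ifs at * <;> omega
      · exact g2.symm
    refine ⟨(true, ⟨i2, b1, b2, s3⟩), ?_, ?_⟩
    · rw [hl]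
      simp only [XX]
      rw [mkL_pos s1]
    · rw [hl]
      simp only [YY]
      rw [mkL_pos s2]

theorem Bp_r {b b' : Bool} {l1 l2 : Letter} (h : Bp (wrf b l1) (wrf b' l2)) : Bp l1 l2 := by
  obtain ⟨r, h1, h2⟩ := h
  have hv := valid_lead r
  have hc := lead_col r
  rcases r with ⟨_ | _, ⟨i, a, c, h⟩⟩
  · obtain ⟨e1, e2, e3⟩ := mkL_inj (supp_r l1 _) hv.1 h1
    obtain ⟨f1, f2, f3⟩ := mkL_inj (supp_r l2 _) hv.2 h2
    subst e2 f2
    obtain ⟨i1, a1, b1, s1⟩ := l1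
    obtain ⟨i2, a2, b2, s2⟩ := l2
    simp only at e1 e3 f1 f3
    subst e1 f1
    have e4 : b1 = b2 := e3.trans f3.symm
    have g1 := congrArg Prod.fst f3
    have g2 := f3.symm ▸ lead_col _
    clear h1 h2 hv hc e3 f3
    subst e4
    have s3 : supp i1 a1 a2 := valid_supp_false s1 s2
    have hl : lead (false, ⟨i1, a1, a2, s3⟩) = b1 := by
      have t1 := s1
      have t2 := s2
      simp only [supp] at t1 t2
      simp only [lead, Letter.top, topn] at *
      apply Prod.ext
      · simp only
        split_ifs at * <;> omega
      · exact g2.symm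
    refine ⟨(false, ⟨i1, a1, a2, s3⟩), ?_, ?_⟩
    · rw [hl]
      simp only [XX]
      rw [mkL_pos s1]
    · rw [hl]
      simp only [YY]
      rw [mkL_pos s2]
  · have := (mkL_inj (supp_r l1 _) hv.1 h1).2.1
    rw [← this] at hc
    exact absurd hc (col_ne_kp _ _)

theorem wl_split (w : List Letter) : ∀ (b : Bool) (α β : List Letter) (x y : Letter),
    wl b w = α ++ x :: y :: β → ∃ α' β' l1 l2 b', w = α' ++ l1 :: l2 :: β' ∧
      x = wlf b' l1 ∧ y = wlf (!b') l2 := by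
  induction w with
  | nil => intro b α β x y h; simp [wl] at h
  | cons l w ih =>
    intro b α β x y h
    cases α with
    | nil =>
      cases w with
      | nil => simp [wl] at h
      | cons l2 w =>
        simp only [wl, List.nil_append, List.cons.injEq] at h
        exact ⟨[], w, l, l2, b, rfl, h.1.symm, h.2.1.symm⟩
    | cons z α =>
      simp only [wl, List.cons_append, List.cons.injEq] at h
      obtain ⟨α', β', l1, l2, b', h1, h2⟩ := ih _ _ _ _ _ h.2
      exact ⟨l :: α', β', l1, l2, b', by rw [h1]; rfl, h2⟩

theorem wr_split (w : List Letter) : ∀ (b : Bool) (α β : List Letter) (x y : Letter),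
    wr b w = α ++ x :: y :: β → ∃ α' β' l1 l2 b', w = α' ++ l1 :: l2 :: β' ∧
      x = wrf b' l1 ∧ y = wrf (!b') l2 := by
  induction w with
  | nil => intro b α β x y h; simp [wr] at h
  | cons l w ih =>
    intro b α β x y h
    cases α with
    | nil =>
      cases w with
      | nil => simp [wr] at h
      | cons l2 w =>
        simp only [wr, List.nil_append, List.cons.injEq] at h
        exact ⟨[], w, l, l2, b, rfl, h.1.symm, h.2.1.symm⟩
    | cons z α =>
      simp only [wr, List.cons_append, List.cons.injEq] at h
      obtain ⟨α', β', l1, l2, b', h1, h2⟩ := ih _ _ _ _ _ h.2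
      exact ⟨l :: α', β', l1, l2, b', by rw [h1]; rfl, h2⟩

theorem C3l (b : Bool) (w : List Letter) (h : ¬ (Sys k).Bad w) : ¬ (Sys k).Bad (wl b w) := by
  rw [bad_iff] at *
  rintro ⟨x, y, α, β, e, hb⟩
  obtain ⟨α', β', l1, l2, b', h1, rfl, rfl⟩ := wl_split _ _ _ _ _ _ e
  exact h ⟨l1, l2, α', β', h1, Bp_l hb⟩

theorem C3r (b : Bool) (w : List Letter) (h : ¬ (Sys k).Bad w) : ¬ (Sys k).Bad (wr b w) := by
  rw [bad_iff] at *
  rintro ⟨x, y, α, β, e, hb⟩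
  obtain ⟨α', β', l1, l2, b', h1, rfl, rfl⟩ := wr_split _ _ _ _ _ _ e
  exact h ⟨l1, l2, α', β', h1, Bp_r hb⟩

theorem C4 (w : List Letter) : ∀ (b : Bool) (w₂ : List Letter),
    wl b w = wl b w₂ → wr b w = wr b w₂ → w = w₂ := by
  induction w with
  | nil =>
    intro b w₂ h1 h2
    cases w₂ with
    | nil => rfl
    | cons l w => simp [wl] at h1
  | cons l w ih =>
    intro b w₂ h1 h2
    cases w₂ with
    | nil => simp [wl] at h1
    | cons l₂ w₂ =>
      simp only [wl, wr, List.cons.injEq] at h1 h2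
      rw [ih _ _ h1.2 h2.2]
      congr 1
      obtain ⟨e1, e2, e3⟩ := mkL_inj (supp_l l _) (supp_l l₂ _) h1.1
      obtain ⟨f1, f2, f3⟩ := mkL_inj (supp_r l _) (supp_r l₂ _) h2.1
      ext1 <;> assumption

end HopfEx

namespace HopfEx
open TensorProduct

variable (k : Type*) [Field k]

noncomputable def rG (m : ℕ) : GJ →* GJ := FreeGroup.lift (fun c : J => if c.1 ≤ m then FreeGroup.of c else 1)

theorem rG_mk (m : ℕ) (L : List (J × Bool)) :
    rG m (FreeGroup.mk L) = FreeGroup.mk (L.filter (fun p => p.1.1 ≤ m)) := by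
  induction L with
  | nil => rw [← FreeGroup.one_eq_mk, map_one, List.filter_nil, ← FreeGroup.one_eq_mk]
  | cons p L ih =>
    have : FreeGroup.mk (p :: L) = FreeGroup.mk [p] * FreeGroup.mk L := by
      rw [FreeGroup.mul_mk]; rfl
    rw [this, map_mul, ih, List.filter_cons]
    obtain ⟨c, e⟩ := p
    have h2 : rG m (FreeGroup.mk [(c, e)]) = if c.1 ≤ m then FreeGroup.mk [(c, e)] else 1 := by
      rw [rG, FreeGroup.lift_mk]
      simp only [List.map_cons, List.map_nil, List.prod_cons, List.prod_nil, mul_one]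
      split_ifs
      · cases e
        · simp [FreeGroup.of, FreeGroup.inv_mk, FreeGroup.invRev]
        · simp [FreeGroup.of]
      · cases e <;> simp
    rw [h2]
    by_cases hc : c.1 ≤ m
    · simp [hc]
    · simp [hc]

theorem rG_gp {m : ℕ} (i : ℤ) {c : J} (h : c.1 ≤ m) : rG m (gp i c) = gp i c := by
  rw [gp, rG_mk]; simp [h]

theorem rG_idem (m : ℕ) (g : GJ) : rG m (rG m g) = rG m g := by
  rw [← FreeGroup.mk_toWord (x := g), rG_mk, rG_mk, List.filter_filter]
  simp

theorem rG_fix {m : ℕ} {L : List (J × Bool)} (hL : FreeGroup.IsReduced L)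
    (h : rG m (FreeGroup.mk L) = FreeGroup.mk L) : ∀ p ∈ L, p.1.1 ≤ m := by
  rw [rG_mk] at h
  have h1 := FreeGroup.norm_mk_le (L₁ := L.filter (fun p => decide (p.1.1 ≤ m)))
  rw [h, FreeGroup.norm, FreeGroup.toWord_mk, hL.reduce_eq] at h1
  have h2 := List.length_filter_le (fun p => decide (p.1.1 ≤ m)) L
  have h3 := List.length_filter_eq_length_iff.1 (le_antisymm h2 h1)
  intro p hp
  simpa using h3 p hp

/-- for each group element, all large retractions fix it -/
theorem rG_large (g : GJ) : ∃ m0, ∀ m, m0 ≤ m → rG m g = g := by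
  rw [← FreeGroup.mk_toWord (x := g)]
  generalize g.toWord = L
  refine ⟨(L.map (fun p => p.1.1)).sum, fun m hm => ?_⟩
  rw [rG_mk, List.filter_eq_self.2]
  intro p hp
  have := List.single_le_sum (l := L.map (fun p => p.1.1)) (by simp) p.1.1 (List.mem_map.2 ⟨p, hp, rfl⟩)
  simp; omega

noncomputable def rK (m : ℕ) : KG k →ₐ[k] KG k := MonoidAlgebra.mapDomainAlgHom k k (rG m)

theorem rK_single (m : ℕ) (g : GJ) (a : k) : rK k m (MonoidAlgebra.single g a) = MonoidAlgebra.single (rG m g) a := by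
  simp [rK]

theorem rK_large (p : KG k) : ∃ m0, ∀ m, m0 ≤ m → rK k m p = p := by
  induction p using MonoidAlgebra.induction_linear with
  | zero => exact ⟨0, fun m _ => map_zero _⟩
  | add x y hx hy =>
    obtain ⟨a, ha⟩ := hx
    obtain ⟨b, hb⟩ := hy
    refine ⟨max a b, fun m hm => ?_⟩
    rw [map_add, ha m (by omega), hb m (by omega)]
  | single g a =>
    obtain ⟨m0, h⟩ := rG_large g
    exact ⟨m0, fun m hm => by rw [rK_single, h m hm]⟩

theorem rK_coeff (m : ℕ) (τ : GJ) (h : rG m τ ≠ τ) (p : KG k) : (rK k m p).coeff τ = 0 := by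
  induction p using MonoidAlgebra.induction_linear with
  | zero => simp
  | add x y hx hy => rw [map_add, MonoidAlgebra.coeff_add, Finsupp.add_apply, hx, hy, add_zero]
  | single g a =>
    rw [rK_single, MonoidAlgebra.coeff_single, Finsupp.single_apply, if_neg]
    rintro rfl
    exact h (rG_idem m g)

noncomputable def R3 (m : ℕ) : T3 k →ₐ[k] T3 k :=
  (Algebra.TensorProduct.map (AlgHom.id k _) (Algebra.TensorProduct.map (rK k m) (AlgHom.id k _)) :
    HA k ⊗[k] (KG k ⊗[k] HA k) →ₐ[k] HA k ⊗[k] (KG k ⊗[k] HA k))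

theorem R3_t3 (m x p y) : R3 k m (t3 k x p y) = t3 k x (rK k m p) y := rfl

theorem cf_R3 (m : ℕ) (τ : GJ) (h : rG m τ ≠ τ) (Z : T3 k) : cf k τ (R3 k m Z) = 0 := by
  induction Z using T3.ind with
  | h0 => simp only [map_zero]
  | h2 s t hs ht => rw [map_add, map_add, hs, ht, add_zero]
  | h1 s u v => rw [R3_t3, cf_t3, rK_coeff k m τ h, zero_smul]

noncomputable def Dm (m : ℕ) : Subalgebra k (HA k) := AlgHom.equalizer ((R3 k m).comp (Psi k)) (Psi k)

theorem mem_Dm {m : ℕ} {x : HA k} : x ∈ Dm k m ↔ R3 k m (Psi k x) = Psi k x := Iff.rfl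

theorem mat_mem_Dm {m : ℕ} {i a b} (h : topn i a b ≤ m) : mat k i a b ∈ Dm k m := by
  rw [mem_Dm, Psi_mat k h, map_sum]
  apply Finset.sum_congr rfl
  intro c hc
  rw [R3_t3, rK_single, rG_gp _ (mem_bx.1 hc)]

theorem wd_mem_Dm {m : ℕ} (w : List Letter) (h : ∀ l ∈ w, l.top ≤ m) : (Sys k).wd w ∈ Dm k m := by
  induction w with
  | nil => rw [(Sys k).wd_nil]; exact one_mem _
  | cons l w ih =>
    rw [(Sys k).wd_cons, gen_eq]
    exact mul_mem (mat_mem_Dm k (h l (by simp))) (ih (fun l' hl' => h l' (by simp [hl'])))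

/-- coordinate functional on the normal basis -/
noncomputable def co (w : List Letter) : HA k →ₗ[k] k := Finsupp.lapply w ∘ₗ (Sys k).NF

noncomputable instance : DecidableEq Letter := Classical.decEq _

theorem co_wd {v w : List Letter} (h : ¬ (Sys k).Bad v) : co k w ((Sys k).wd v) = if v = w then 1 else 0 := by
  simp only [co, LinearMap.comp_apply, (Sys k).NF_wd, (Sys k).N_normal v h, Finsupp.lapply_apply,
    Finsupp.single_apply]

noncomputable def fn (w0 : List Letter) : HA k →ₗ[k] k :=
  (TensorProduct.lid k k).toLinearMap ∘ₗ
    TensorProduct.map (co k (wl true w0)) (co k (wr true w0)) ∘ₗ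
    cf k (FreeGroup.mk (mkl true w0)) ∘ₗ (Psi k).toLinearMap

theorem fn_apply (w0 x) : fn k w0 x = TensorProduct.lid k k
    (TensorProduct.map (co k (wl true w0)) (co k (wr true w0))
      (cf k (FreeGroup.mk (mkl true w0)) (Psi k x))) := rfl

theorem fn_wd {w0 w : List Letter} (hn : ¬ (Sys k).Bad w)
    (hlen : w.length ≤ w0.length) (hst : w.length = w0.length → st w ≤ st w0) :
    fn k w0 ((Sys k).wd w) = if w = w0 then 1 else 0 := by
  rw [fn_apply]
  rcases hlen.lt_or_eq with h | h
  · rw [claimA k w _ (mkl_red _ _) (by rwa [mkl_length]), if_neg (by rintro rfl; simp at h)]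
    simp
  · rcases C1 k w0 true w h with h0 | ⟨-, h2⟩
    · rw [h0, if_neg]
      · simp
      rintro rfl
      rw [C2] at h0
      have := congrArg (fun z => TensorProduct.lid k k
        (TensorProduct.map (co k (wl true w)) (co k (wr true w)) z)) h0
      simp [co_wd k (C3l k true w hn), co_wd k (C3r k true w hn)] at this
    · rw [← h2 (hst h), C2]
      simp only [TensorProduct.map_tmul, co_wd k (C3l k true w hn), co_wd k (C3r k true w hn)]
      by_cases e : w = w0
      · subst e; simp
      · rw [if_neg e]
        by_cases e1 : wl true w = wl true w0
        · have e2 : wr true w ≠ wr true w0 := fun e2 => e (C4 w true w0 e1 e2)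
          simp [e2]
        · simp [e1]

theorem lemK {m : ℕ} (v : List Letter →₀ k) (hv : ∀ w ∈ v.support, ¬ (Sys k).Bad w)
    (hne : v ≠ 0) (hD : (Sys k).ev v ∈ Dm k m) : ∃ w ∈ v.support, ∀ l ∈ w, l.top ≤ m := by
  obtain ⟨w0, hw0, hmax⟩ := Finset.exists_max_image v.support
    (fun w => toLex (w.length, st w)) (Finsupp.support_nonempty_iff.2 hne)
  refine ⟨w0, hw0, ?_⟩
  have h1 : fn k w0 ((Sys k).ev v) = v w0 := by
    conv_lhs => rw [← Finsupp.sum_single v, Finsupp.sum, map_sum, map_sum]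
    rw [Finset.sum_eq_single w0]
    · rw [(Sys k).ev_single, map_smul, fn_wd k (hv _ hw0) le_rfl (fun _ => le_rfl)]
      simp
    · intro w hw hne
      have := hmax w hw
      rw [Prod.Lex.toLex_le_toLex] at this
      simp only at this
      rw [(Sys k).ev_single, map_smul, fn_wd k (hv _ hw) (by omega) (by omega), if_neg hne, smul_zero]
    · intro h; exact absurd hw0 h
  have h2 : rG m (FreeGroup.mk (mkl true w0)) = FreeGroup.mk (mkl true w0) := by
    by_contra h
    rw [fn_apply, ← mem_Dm k |>.1 hD, cf_R3 k m _ h] at h1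
    simp only [map_zero] at h1
    exact Finsupp.mem_support_iff.1 hw0 h1.symm
  have h3 := rG_fix (mkl_red _ _) h2
  have aux : ∀ (w : List Letter) (b : Bool), (∀ p ∈ mkl b w, p.1.1 ≤ m) → ∀ l ∈ w, l.top ≤ m := by
    intro w
    induction w with
    | nil => simp
    | cons l w ih =>
      intro b h
      simp only [mkl, List.mem_cons, forall_eq_or_imp] at h ⊢
      exact ⟨h.1, ih _ h.2⟩
  exact aux w0 true h3

theorem Dm_supp {m : ℕ} {x : HA k} (hx : x ∈ Dm k m) :
    ∀ w ∈ ((Sys k).NF x).support, ∀ l ∈ w, l.top ≤ m := by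
  classical
  set v := (Sys k).NF x with hv
  let G : List Letter → Prop := fun w => ∀ l ∈ w, l.top ≤ m
  have hsplit := Finsupp.filter_add_filter_not v G
  have hg : (Sys k).ev (v.filter G) ∈ Dm k m := by
    rw [← Finsupp.sum_single (v.filter G), Finsupp.sum, map_sum]
    apply sum_mem
    intro w hw
    rw [(Sys k).ev_single]
    apply Subalgebra.smul_mem
    apply wd_mem_Dm
    rw [Finsupp.support_filter, Finset.mem_filter] at hw
    exact hw.2
  have hb : (Sys k).ev (v.filter (fun w => ¬ G w)) ∈ Dm k m := by
    have : (Sys k).ev (v.filter (fun w => ¬ G w)) = x - (Sys k).ev (v.filter G) := by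
      rw [eq_sub_iff_add_eq', ← map_add, hsplit, hv, (Sys k).ev_NF]
    rw [this]
    exact sub_mem hx hg
  have hz : v.filter (fun w => ¬ G w) = 0 := by
    by_contra hne
    obtain ⟨w, hw, hw2⟩ := lemK k (v.filter (fun w => ¬ G w)) (by
      intro w hw
      rw [Finsupp.support_filter, Finset.mem_filter] at hw
      exact (Sys k).NF_supp_normal x w hw.1) hne hb
    rw [Finsupp.support_filter, Finset.mem_filter] at hw
    exact hw.2 hw2
  intro w hw
  by_contra hG
  have := DFunLike.congr_fun hz w
  rw [Finsupp.filter_apply_pos (fun w => ¬ G w) v hG] at this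
  exact Finsupp.mem_support_iff.1 hw this

/-- span of words of level at least `N` -/
noncomputable def Lev (N : ℤ) : Submodule k (HA k) :=
  Submodule.span k ((Sys k).wd '' {w | ∀ l ∈ w, N ≤ l.i})

theorem Dm_Lev {m : ℕ} {x : HA k} (hx : x ∈ Dm k m) : x ∈ Lev k (-m) := by
  rw [← (Sys k).ev_NF x, ← Finsupp.sum_single ((Sys k).NF x), Finsupp.sum, map_sum]
  apply sum_mem
  intro w hw
  rw [(Sys k).ev_single]
  apply Submodule.smul_mem
  apply Submodule.subset_span
  refine ⟨w, fun l hl => ?_, rfl⟩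
  have := Dm_supp k hx w hw l hl
  simp only [Letter.top, topn] at this
  omega

theorem S2_wd {N : ℤ} (w : List Letter) (h : ∀ l ∈ w, N ≤ l.i) : S2 k ((Sys k).wd w) = 0 ∨
    ∃ w', S2 k ((Sys k).wd w) = (Sys k).wd w' ∧ ∀ l ∈ w', N + 2 ≤ l.i := by
  induction w with
  | nil => right; exact ⟨[], by simp, by simp⟩
  | cons l w ih =>
    rw [(Sys k).wd_cons, map_mul, gen_eq, S2_mat]
    by_cases hs : supp (l.i + 2) l.a l.b
    · rcases ih (fun l' hl' => h l' (by simp [hl'])) with h0 | ⟨w', h1, h2⟩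
      · left; rw [h0, mul_zero]
      · right
        refine ⟨mkL (l.i + 2) l.a l.b :: w', ?_, ?_⟩
        · rw [h1, (Sys k).wd_cons, mat, if_pos hs]
        · simp only [List.mem_cons, forall_eq_or_imp]
          refine ⟨?_, h2⟩
          rw [mkL_pos hs]
          have := h l (by simp)
          simp only
          omega
    · left
      rw [(matFam k).off hs, zero_mul]

theorem S2_Lev {N : ℤ} {x : HA k} (hx : x ∈ Lev k N) : S2 k x ∈ Lev k (N + 2) := by
  induction hx using Submodule.span_induction with
  | mem x h =>
    obtain ⟨w, hw, rfl⟩ := h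
    rcases S2_wd k w hw with h0 | ⟨w', h1, h2⟩
    · rw [h0]; exact zero_mem _
    · rw [h1]; exact Submodule.subset_span ⟨w', h2, rfl⟩
  | zero => rw [map_zero]; exact zero_mem _
  | add x y _ _ hx hy => rw [map_add]; exact add_mem hx hy
  | smul a x _ hx => rw [map_smul]; exact Submodule.smul_mem _ _ hx

theorem S2_iter_Lev {N : ℤ} {x : HA k} (hx : x ∈ Lev k N) (n : ℕ) :
    (S2 k)^[n] x ∈ Lev k (N + 2 * n) := by
  induction n with
  | zero => simpa using hx
  | succ n ih =>
    rw [Function.iterate_succ_apply']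
    have := S2_Lev k ih
    convert this using 2
    push_cast; ring

theorem Lev_supp {N : ℤ} {x : HA k} (hx : x ∈ Lev k N) :
    ∀ w ∈ ((Sys k).NF x).support, ∀ l ∈ w, N ≤ l.i := by
  have : (Sys k).NF x ∈ Finsupp.supported k k {v : List Letter | ∀ l ∈ v, N ≤ l.i} := by
    induction hx using Submodule.span_induction with
    | mem x h =>
      obtain ⟨w, hw, rfl⟩ := h
      rw [(Sys k).NF_wd]
      apply (Sys k).N_supp_pred (fun l => N ≤ l.i) _ w hw
      intro r c hc h1 h2
      have hv := mem_CC.1 hc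
      have hl := valid_lead r
      change N ≤ (XX r (lead r)).i at h1
      change N ≤ (YY r (lead r)).i at h2
      change N ≤ (XX r c).i ∧ N ≤ (YY r c).i
      rcases r with ⟨_ | _, l⟩
      · simp only [XX, YY] at h1 h2 ⊢
        rw [mkL_pos hl.1] at h1
        rw [mkL_pos hl.2] at h2
        rw [mkL_pos hv.1, mkL_pos hv.2]
        exact ⟨h1, h2⟩
      · simp only [XX, YY] at h1 h2 ⊢
        rw [mkL_pos hl.1] at h1
        rw [mkL_pos hl.2] at h2
        rw [mkL_pos hv.1, mkL_pos hv.2]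
        exact ⟨h1, h2⟩
    | zero => rw [map_zero]; exact zero_mem _
    | add x y _ _ hx hy => rw [map_add]; exact add_mem hx hy
    | smul a x _ hx => rw [map_smul]; exact Submodule.smul_mem _ _ hx
  intro w hw
  exact (Finsupp.mem_supported k _).1 this hw

theorem inter_Lev {x : HA k} (h : ∀ N : ℤ, x ∈ Lev k N) : x = algebraMap k _ (Eps k x) := by
  have hs : ∀ w ∈ ((Sys k).NF x).support, w = [] := by
    intro w hw
    cases w with
    | nil => rfl
    | cons l w =>
      have := Lev_supp k (h (l.i + 1)) _ hw l (by simp)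
      omega
  obtain ⟨a, ha⟩ : ∃ a : k, (Sys k).NF x = Finsupp.single [] a := by
    refine ⟨(Sys k).NF x [], ?_⟩
    apply Finsupp.eq_single_iff.2
    refine ⟨fun w hw => ?_, rfl⟩
    simp [hs w hw]
  have hx : x = algebraMap k _ a := by
    rw [← (Sys k).ev_NF x, ha, (Sys k).ev_single, (Sys k).wd_nil, Algebra.algebraMap_eq_smul_one]
  have h2 : Eps k x = a := by
    rw [hx, AlgHom.commutes]; rfl
  rw [h2]; exact hx

end HopfEx

namespace HopfEx
open TensorProduct

section main
variable {k : Type*} [Field k] {H' : Type*} [Ring H'] [HopfAlgebra k H']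

/-- a linear map compatible with the comultiplication and killed by `Pi` -/
structure Good (f : H' →ₐc[k] HA k) (L : H' →ₗ[k] H') : Prop where
  com : ∀ x, Coalgebra.comul (R := k) (L x) = TensorProduct.map L L (Coalgebra.comul (R := k) x)
  pi : ∀ x, Pi k (f (L x)) = Pi k (f x)

/-- the linear map underlying `f` -/
noncomputable def fl (f : H' →ₐc[k] HA k) : H' →ₗ[k] HA k := (f : H' →ₗ[k] HA k)

theorem fl_apply (f : H' →ₐc[k] HA k) (x) : fl f x = f x := rfl

theorem Delta_f (f : H' →ₐc[k] HA k) (x) :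
    Delta k (f x) = TensorProduct.map (fl f) (fl f) (Coalgebra.comul (R := k) x) :=
  (CoalgHomClass.map_comp_comul_apply f x).symm

noncomputable def FL (f : H' →ₐc[k] HA k) (L : H' →ₗ[k] H') :
    H' ⊗[k] (H' ⊗[k] H') →ₗ[k] HA k ⊗[k] (KG k ⊗[k] HA k) :=
  TensorProduct.map (fl f ∘ₗ L) (TensorProduct.map ((Pi k).toLinearMap ∘ₗ fl f) (fl f ∘ₗ L))

theorem Psi_f (f : H' →ₐc[k] HA k) (L : H' →ₗ[k] H') (hL : Good f L) (c : H') :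
    T3.toE k (Psi k (f (L c))) =
      FL f L (TensorProduct.map LinearMap.id Coalgebra.comul (Coalgebra.comul (R := k) c)) := by
  rw [Psi_lin, Delta_f, hL.com]
  generalize Coalgebra.comul (R := k) c = Z
  induction Z with
  | zero => simp only [map_zero]
  | add s t hs ht => simp only [map_add, hs, ht]
  | tmul a b =>
    simp only [TensorProduct.map_tmul, LinearMap.id_coe, id_eq, AlgHom.toLinearMap_apply, FL,
      fl_apply, LinearMap.comp_apply]
    rw [Delta_f, hL.com]
    congr 1
    generalize Coalgebra.comul (R := k) b = Z
    induction Z with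
    | zero => simp only [map_zero]
    | add s t hs ht => simp only [map_add, hs, ht]
    | tmul a b =>
      simp only [TensorProduct.map_tmul, LinearMap.id_coe, id_eq, AlgHom.toLinearMap_apply,
        fl_apply, LinearMap.comp_apply, hL.pi]

theorem FL_large (f : H' →ₐc[k] HA k) (Z : H' ⊗[k] (H' ⊗[k] H')) : ∃ m0, ∀ m, m0 ≤ m →
    ∀ L : H' →ₗ[k] H', R3 k m ((T3.toE k).symm (FL f L Z)) = (T3.toE k).symm (FL f L Z) := by
  induction Z with
  | zero => exact ⟨0, fun m _ L => by simp only [map_zero]⟩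
  | add s t hs ht =>
    obtain ⟨a, ha⟩ := hs
    obtain ⟨b, hb⟩ := ht
    refine ⟨max a b, fun m hm L => ?_⟩
    simp only [map_add, ha m (by omega) L, hb m (by omega) L]
  | tmul x Y =>
    induction Y with
    | zero => exact ⟨0, fun m _ L => by simp only [tmul_zero, map_zero]⟩
    | add s t hs ht =>
      obtain ⟨a, ha⟩ := hs
      obtain ⟨b, hb⟩ := ht
      refine ⟨max a b, fun m hm L => ?_⟩
      simp only [tmul_add, map_add, ha m (by omega) L, hb m (by omega) L]
    | tmul y z =>
      obtain ⟨m0, h⟩ := rK_large k (Pi k (f y))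
      refine ⟨m0, fun m hm L => ?_⟩
      have e : (T3.toE k).symm (FL f L (x ⊗ₜ (y ⊗ₜ z))) =
        t3 k (f (L x)) (Pi k (f y)) (f (L z)) := rfl
      rw [e, R3_t3, h m hm]

theorem Lev_anti {N N' : ℤ} (h : N ≤ N') {x : HA k} (hx : x ∈ Lev k N') : x ∈ Lev k N := by
  refine Submodule.span_mono ?_ hx
  apply Set.image_mono
  intro w hw l hl
  exact h.trans (hw l hl)

theorem trivial_of_bij (hS : Function.Bijective (HopfAlgebra.antipode k (A := H')))
    (f : H' →ₐc[k] HA k) (c : H') :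
    f c = algebraMap k (HA k) (Coalgebra.counit (R := k) c) := by
  let T : H' ≃ₗ[k] H' := LinearEquiv.ofBijective
    (HopfAlgebra.antipode k (A := H') ∘ₗ HopfAlgebra.antipode k (A := H')) (hS.comp hS)
  have hT : ∀ x, T x = HopfAlgebra.antipode k (HopfAlgebra.antipode k x) := fun x => rfl
  have hf : ∀ x, f (T x) = S2 k (f x) := by
    intro x
    rw [hT, hom_antipode, hom_antipode]
    rfl
  let L : ℕ → (H' →ₗ[k] H') := fun n => (T.symm.toLinearMap) ^ n
  have hL0 : ∀ x, L 0 x = x := fun x => rfl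
  have hLs : ∀ n x, L (n + 1) x = T.symm (L n x) := by
    intro n x
    simp only [L, pow_succ']
    rfl
  have hg : ∀ n, Good f (L n) := by
    intro n
    induction n with
    | zero =>
      refine ⟨fun x => ?_, fun x => by rw [hL0]⟩
      rw [hL0]
      have : L 0 = LinearMap.id := rfl
      rw [this, TensorProduct.map_id]; rfl
    | succ n ih =>
      refine ⟨fun x => ?_, fun x => ?_⟩
      · rw [hLs]
        have h1 := comul_antipode_sq (k := k) (T.symm (L n x))
        rw [← hT, T.apply_symm_apply, ih.com] at h1
        have e : L (n + 1) = T.symm.toLinearMap ∘ₗ L n := LinearMap.ext (hLs n)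
        rw [e, TensorProduct.map_comp, LinearMap.comp_apply, h1, ← LinearMap.comp_apply,
          ← TensorProduct.map_comp]
        have e2 : T.symm.toLinearMap ∘ₗ (HopfAlgebra.antipode k (A := H') ∘ₗ
            HopfAlgebra.antipode k (A := H')) = LinearMap.id := by
          ext y
          exact T.symm_apply_apply y
        rw [e2, TensorProduct.map_id]; rfl
      · rw [hLs, ← Pi_S2, ← hf, T.apply_symm_apply, ih.pi]
  have hit : ∀ n x, (S2 k)^[n] (f (L n x)) = f x := by
    intro n
    induction n with
    | zero => intro x; rfl
    | succ n ih =>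
      intro x
      rw [Function.iterate_succ_apply, hLs, ← hf, T.apply_symm_apply, ih]
  obtain ⟨m, hm⟩ := FL_large f
    (TensorProduct.map LinearMap.id Coalgebra.comul (Coalgebra.comul (R := k) c))
  have hD : ∀ n, f (L n c) ∈ Dm k m := by
    intro n
    have := hm m le_rfl (L n)
    rw [← Psi_f f _ (hg n), LinearEquiv.symm_apply_apply] at this
    exact this
  have hLev : ∀ N : ℤ, f c ∈ Lev k N := by
    intro N
    have := S2_iter_Lev k (Dm_Lev k (hD (N + m).toNat)) (N + m).toNat
    rw [hit] at this
    exact Lev_anti (by omega) this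
  have := inter_Lev k hLev
  rw [this, ← counit_eq]
  congr 1
  exact CoalgHomClass.counit_comp_apply f c

end main

end HopfEx

/-!
STATEMENT 0: For every field `k` there exists a `k`-Hopf algebra `H` whose antipode is
surjective but not injective, and such that every `k`-bialgebra homomorphism from a
`k`-Hopf algebra with bijective antipode to `H` is trivial (i.e. sends `h` to `ε(h)·1`).
-/

universe u v

theorem hopf_algebra_with_surjective_non_injective_antipode_receiving_only_trivial_maps
    (k : Type u) [Field k] :
    ∃ (H : Type u) (_ : Ring H) (_ : HopfAlgebra k H),
      Function.Surjective (HopfAlgebra.antipode (R := k) (A := H)) ∧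
      ¬ Function.Injective (HopfAlgebra.antipode (R := k) (A := H)) ∧
      ∀ (H' : Type v) (_ : Ring H') (_ : HopfAlgebra k H'),
        Function.Bijective (HopfAlgebra.antipode (R := k) (A := H')) →
        ∀ f : H' →ₐc[k] H, ∀ h : H',
          f h = algebraMap k H (Coalgebra.counit (R := k) h) := by
  refine ⟨HopfEx.HA k, inferInstance, inferInstance, HopfEx.Sl_surj k, HopfEx.Sl_not_inj k, ?_⟩
  intro H' _ _ hS f h
  exact HopfEx.trivial_of_bij hS f h
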